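/- arXiv:2405.14395 — 2 statements merged into one kernel-verified Lean document; each statement's English description precedes it below -/
import Mathlib

section
/- Let s₀ ≠ s₁ ∈ S, define the Luo sequence s_{n+1} = w_{S∖{s_n}} s_{n−1} w_{S∖{s_n}}, and let c be its minimal positive period. Set P_i = P_{S∖{s_i, s_{i+1}}} and w_i = w_{S∖{s_i}}, and let D = a_{P₀ w₁ P₁} · a_{P₁ w₂ P₂} ⋯ a_{P_{c−1} w_c P_c} ∈ ℂG (indices mod c, so P_c = P₀). Then there exists an integer m > 0 with c | 2m such that D^{2m/c} = a_{P₀ w_S P_m} · a_{P_m w_S P₀}, where P_m = P_{S∖{s_m, s_{m+1}}} satisfies w_S(S∖{s₀,s₁})w_S = S∖{s_m,s_{m+1}}, i.e. P_m and P₀ are opposite standard parabolic subgroups. -/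
/-!
STATEMENT 9. Let G be a finite group with a BN-pair whose Weyl group W = N/(B ∩ N) is
finite, with generating set S of involutions, longest elements w_J of the standard
parabolic subgroups W_J (provided as data `wl J` with the characterizing property),
standard parabolics P_I = B W_I B, and a_{PwQ} = |Q|⁻¹ Σ_{x∈PwQ} x ∈ ℂG.
Let s₀ ≠ s₁ ∈ S, define the Luo sequence s_{n+1} = w_{S∖{s_n}} s_{n−1} w_{S∖{s_n}}, and
let c be its minimal positive period. Set P_i = P_{S∖{s_i,s_{i+1}}}, w_i = w_{S∖{s_i}},
and D = a_{P₀w₁P₁} ⋯ a_{P_{c−1}w_cP_c} (indices mod c). Then there is an integer m > 0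
with c ∣ 2m such that D^{2m/c} = a_{P₀ w_S P_m} · a_{P_m w_S P₀}, where
P_m = P_{S∖{s_m,s_{m+1}}} satisfies w_S(S∖{s₀,s₁})w_S = S∖{s_m,s_{m+1}}, i.e. P_m and
P₀ are opposite standard parabolic subgroups.
-/


open scoped Pointwise

variable {G : Type*} [Group G]

/-- The set of lifts in `G` of an element of the Weyl group `W = N/(B ⊓ N)` of a
BN-pair. (All statements about double cosets `BwB` are independent of the lift.) -/
def lifts (B N : Subgroup G) (w : ↥N ⧸ (B ⊓ N).subgroupOf N) : Set G :=
  {g : G | ∃ x : ↥N, QuotientGroup.mk x = w ∧ g = (x : G)}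

/-- The double coset `BwB ⊆ G`, for `w` in the Weyl group. -/
def BwB (B N : Subgroup G) (w : ↥N ⧸ (B ⊓ N).subgroupOf N) : Set G :=
  (B : Set G) * lifts B N w * (B : Set G)

/-- The standard parabolic subgroup `P_I = B W_I B ⊆ G` (as a subset of `G`),
for a subset `I` of the Weyl group. -/
def para (B N : Subgroup G) [((B ⊓ N).subgroupOf N).Normal] (I : Set (↥N ⧸ (B ⊓ N).subgroupOf N)) : Set G :=
  {g : G | ∃ w ∈ Subgroup.closure I, g ∈ BwB B N w}

/-- Word length with respect to a generating set `S`. -/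
noncomputable def wordLen {W : Type*} [Monoid W] (S : Set W) (w : W) : ℕ :=
  sInf {m | ∃ L : List W, L.length = m ∧ (∀ x ∈ L, x ∈ S) ∧ L.prod = w}

/-- The element `a_{PwQ} = |Q|⁻¹ Σ_{x ∈ PwQ} x` of the group algebra `ℂG`. -/
noncomputable def aPwQ [Fintype G] (B N : Subgroup G) (P : Set G)
    (w : ↥N ⧸ (B ⊓ N).subgroupOf N) (Q : Set G) : MonoidAlgebra ℂ G :=
  ((Q.ncard : ℂ))⁻¹ •
    ∑ x ∈ (Set.toFinite (P * lifts B N w * Q)).toFinset, MonoidAlgebra.single x (1 : ℂ)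

/-- The idempotent `e_P = |P|⁻¹ Σ_{x ∈ P} x` of the group algebra `ℂG`. -/
noncomputable def ePset [Fintype G] (P : Set G) : MonoidAlgebra ℂ G :=
  ((P.ncard : ℂ))⁻¹ • ∑ x ∈ (Set.toFinite P).toFinset, MonoidAlgebra.single x (1 : ℂ)


namespace S9

structure Cox {W : Type*} [Group W] (S : Set W) : Prop where
  gen : Subgroup.closure S = ⊤
  inv : ∀ s ∈ S, s * s = 1
  ne1 : ∀ s ∈ S, s ≠ 1
  neq : ∀ s ∈ S, ∀ w, wordLen S (s * w) ≠ wordLen S w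
  exch : ∀ s ∈ S, ∀ t ∈ S, ∀ w, wordLen S w < wordLen S (s * w) →
    wordLen S (s * (w * t)) < wordLen S (w * t) → s * w = w * t

section comb
variable {W : Type*} [Group W] {S : Set W}

theorem wl_le (L : List W) (h : ∀ x ∈ L, x ∈ S) : wordLen S L.prod ≤ L.length :=
  Nat.sInf_le ⟨L, rfl, h, rfl⟩

theorem exists_J (hinv : ∀ s ∈ S, s * s = 1) {J : Set W} (hJ : J ⊆ S) {u : W}
    (hu : u ∈ Subgroup.closure J) : ∃ L : List W, (∀ x ∈ L, x ∈ J) ∧ L.prod = u := by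
  rw [← Subgroup.mem_toSubmonoid, Subgroup.closure_toSubmonoid] at hu
  obtain ⟨L, hL, rfl⟩ := Submonoid.exists_list_of_mem_closure hu
  refine ⟨L, fun x hx => ?_, rfl⟩
  rcases (hL x hx : x ∈ J ∨ x⁻¹ ∈ J) with h | h
  · exact h
  · have := hinv _ (hJ h)
    have h2 : x = x⁻¹ := by
      rw [← mul_inv_rev, inv_eq_one] at this
      exact eq_inv_of_mul_eq_one_left this
    rw [h2]; exact h

theorem exists_red' (hgen : Subgroup.closure S = ⊤) (hinv : ∀ s ∈ S, s * s = 1) (w : W) :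
    ∃ L : List W, L.length = wordLen S w ∧ (∀ x ∈ L, x ∈ S) ∧ L.prod = w := by
  have : {m | ∃ L : List W, L.length = m ∧ (∀ x ∈ L, x ∈ S) ∧ L.prod = w}.Nonempty := by
    obtain ⟨L, h1, h2⟩ := exists_J hinv (le_refl S) (u := w) (by rw [hgen]; trivial)
    exact ⟨_, L, rfl, h1, h2⟩
  exact Nat.sInf_mem this

theorem len_one : wordLen S (1 : W) = 0 := by
  have := wl_le (S := S) ([] : List W) (by simp)
  simpa using this

theorem len_mul' (hgen : Subgroup.closure S = ⊤) (hinv : ∀ s ∈ S, s * s = 1) (u v : W) :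
    wordLen S (u * v) ≤ wordLen S u + wordLen S v := by
  obtain ⟨L, h1, h2, h3⟩ := exists_red' hgen hinv u
  obtain ⟨M, k1, k2, k3⟩ := exists_red' hgen hinv v
  have := wl_le (S := S) (L ++ M) (by
    intro x hx; rcases List.mem_append.1 hx with h | h
    · exact h2 x h
    · exact k2 x h)
  rw [List.prod_append, h3, k3, List.length_append] at this
  omega

theorem len_inv_le (hgen : Subgroup.closure S = ⊤) (hinv : ∀ s ∈ S, s * s = 1) (u : W) :
    wordLen S u⁻¹ ≤ wordLen S u := by
  obtain ⟨L, h1, h2, h3⟩ := exists_red' hgen hinv u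
  have hS : ∀ x ∈ S, x⁻¹ = x := fun x hx => inv_eq_of_mul_eq_one_left (hinv x hx)
  have := wl_le (S := S) (L.map (·⁻¹)).reverse (by
    intro x hx
    simp only [List.mem_reverse, List.mem_map] at hx
    obtain ⟨y, hy, rfl⟩ := hx
    rw [hS y (h2 y hy)]; exact h2 y hy)
  rw [← List.prod_inv_reverse, h3] at this
  simpa [h1] using this

theorem len_inv' (hgen : Subgroup.closure S = ⊤) (hinv : ∀ s ∈ S, s * s = 1) (u : W) :
    wordLen S u⁻¹ = wordLen S u :=
  le_antisymm (len_inv_le hgen hinv u) (by simpa using len_inv_le hgen hinv u⁻¹)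

theorem len_zero' (hgen : Subgroup.closure S = ⊤) (hinv : ∀ s ∈ S, s * s = 1) {u : W}
    (h : wordLen S u = 0) : u = 1 := by
  obtain ⟨L, h1, h2, h3⟩ := exists_red' hgen hinv u
  rw [h, List.length_eq_zero_iff] at h1
  subst h1; simpa using h3.symm

theorem len_S_le {s : W} (hs : s ∈ S) : wordLen S s ≤ 1 := by
  have := wl_le (S := S) [s] (by simpa using hs)
  simpa using this

namespace Cox
variable (C : Cox S)
include C

theorem len_mul (u v : W) : wordLen S (u * v) ≤ wordLen S u + wordLen S v :=
  len_mul' C.gen C.inv u v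
theorem len_inv (u : W) : wordLen S u⁻¹ = wordLen S u := len_inv' C.gen C.inv u
theorem len_zero {u : W} (h : wordLen S u = 0) : u = 1 := len_zero' C.gen C.inv h
theorem sinv {s : W} (hs : s ∈ S) : s⁻¹ = s := inv_eq_of_mul_eq_one_left (C.inv s hs)
theorem ss {s : W} (hs : s ∈ S) (w : W) : s * (s * w) = w := by
  rw [← mul_assoc, C.inv s hs, one_mul]
theorem len_S {s : W} (hs : s ∈ S) : wordLen S s = 1 := by
  have := len_S_le hs
  have : wordLen S s ≠ 0 := fun h => C.ne1 s hs (C.len_zero h)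
  omega

theorem len_inv_mul (u v : W) : wordLen S (u⁻¹ * v) = wordLen S (v⁻¹ * u) := by
  rw [← C.len_inv]; simp
theorem len_mul_s {s : W} (hs : s ∈ S) (w : W) : wordLen S (w * s) = wordLen S (s * w⁻¹) := by
  rw [← C.len_inv]; simp [C.sinv hs]

/-- strong exchange for arbitrary words -/
theorem exchange {s : W} (hs : s ∈ S) (L : List W) (hL : ∀ x ∈ L, x ∈ S) :
    ∀ p : W, wordLen S p < wordLen S (s * p) →
    wordLen S (s * (p * L.prod)) < wordLen S (p * L.prod) →
    ∃ L' : List W, L'.Sublist L ∧ L'.length < L.length ∧ s * (p * L.prod) = p * L'.prod := by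
  induction L with
  | nil => intro p h1 h2; simp at h2; omega
  | cons t L ih =>
    intro p h1 h2
    have ht : t ∈ S := hL t (by simp)
    by_cases h : wordLen S (s * (p * t)) < wordLen S (p * t)
    · have := C.exch s hs t ht p h1 h
      refine ⟨L, by simp, by simp, ?_⟩
      rw [List.prod_cons, ← mul_assoc, this, mul_assoc, C.ss ht]
    · have h3 := C.neq s hs (p * t)
      obtain ⟨L', k1, k2, k3⟩ := ih (fun x hx => hL x (by simp [hx])) (p * t) (by omega)
        (by simpa [mul_assoc] using h2)
      refine ⟨t :: L', by simpa using k1, by simpa using k2, ?_⟩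
      simpa [mul_assoc] using k3

theorem exchange1 {s : W} (hs : s ∈ S) (L : List W) (hL : ∀ x ∈ L, x ∈ S)
    (h : wordLen S (s * L.prod) < wordLen S L.prod) :
    ∃ L' : List W, L'.Sublist L ∧ L'.length < L.length ∧ s * L.prod = L'.prod := by
  have := C.exchange hs L hL 1 (by rw [len_one, mul_one, C.len_S hs]; omega) (by simpa using h)
  simpa using this

/-- two-part exchange -/
theorem exchange2 {s : W} (hs : s ∈ S) {u v : W} (hu : wordLen S u < wordLen S (s * u))
    (h : wordLen S (s * (u * v)) < wordLen S (u * v)) :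
    ∃ v', wordLen S v' < wordLen S v ∧ s * (u * v) = u * v' := by
  obtain ⟨L, h1, h2, rfl⟩ := exists_red' C.gen C.inv v
  obtain ⟨L', k1, k2, k3⟩ := C.exchange hs L h2 u hu h
  exact ⟨L'.prod, by have := wl_le (S := S) L' (fun x hx => h2 x (k1.subset hx)); omega, k3⟩

theorem len_s_cases {s : W} (hs : s ∈ S) (w : W) :
    wordLen S (s * w) = wordLen S w + 1 ∨ wordLen S (s * w) + 1 = wordLen S w := by
  have h1 := C.len_mul s w
  have h2 := C.len_mul s (s * w)
  have h3 := C.neq s hs w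
  rw [C.len_S hs] at h1 h2
  rw [C.ss hs] at h2
  omega

/-- reduced words inside `J` -/
theorem red_J {J : Set W} (hJ : J ⊆ S) (L : List W) (hL : ∀ x ∈ L, x ∈ J) :
    ∃ L' : List W, (∀ x ∈ L', x ∈ J) ∧ L'.prod = L.prod ∧ L'.length = wordLen S L.prod := by
  induction L with
  | nil => exact ⟨[], by simp, rfl, by simp [len_one]⟩
  | cons t L ih =>
    obtain ⟨L', k1, k2, k3⟩ := ih (fun x hx => hL x (by simp [hx]))
    have ht : t ∈ J := hL t (by simp)
    rw [List.prod_cons]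
    rcases C.len_s_cases (hJ ht) L.prod with h | h
    · refine ⟨t :: L', ?_, by simp [k2], by simp [k3, h]⟩
      intro x hx; rcases List.mem_cons.1 hx with rfl | hx
      · exact ht
      · exact k1 x hx
    · obtain ⟨M, m1, m2, m3⟩ := C.exchange1 (hJ ht) L' (fun x hx => hJ (k1 x hx))
        (by rw [k2]; omega)
      refine ⟨M, fun x hx => k1 x (m1.subset hx), by rw [← m3, k2], ?_⟩
      have := wl_le (S := S) M (fun x hx => hJ (k1 x (m1.subset hx)))
      rw [← m3, k2] at this
      omega

theorem exists_red {J : Set W} (hJ : J ⊆ S) {u : W} (hu : u ∈ Subgroup.closure J) :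
    ∃ L : List W, (∀ x ∈ L, x ∈ J) ∧ L.prod = u ∧ L.length = wordLen S u := by
  obtain ⟨L, h1, rfl⟩ := exists_J C.inv hJ hu
  exact C.red_J hJ L h1

/-- induction on elements of a parabolic along reduced words -/
theorem J_ind {J : Set W} (hJ : J ⊆ S) {p : W → Prop} (h1 : p 1)
    (hs : ∀ s ∈ J, ∀ u ∈ Subgroup.closure J, wordLen S (s * u) = wordLen S u + 1 → p u → p (s * u))
    {u : W} (hu : u ∈ Subgroup.closure J) : p u := by
  obtain ⟨L, k1, rfl, k3⟩ := C.exists_red hJ hu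
  clear hu
  induction L with
  | nil => simpa using h1
  | cons t L ih =>
    have ht : t ∈ J := k1 t (by simp)
    have hL : ∀ x ∈ L, x ∈ J := fun x hx => k1 x (by simp [hx])
    rw [List.prod_cons] at *
    have e1 := C.len_mul t L.prod
    have e2 := wl_le (S := S) L (fun x hx => hJ (hL x hx))
    rw [C.len_S (hJ ht)] at e1
    simp at k3
    exact hs t ht _ (Subgroup.list_prod_mem _ fun x hx => Subgroup.subset_closure (hL x hx))
      (by omega) (ih hL (by omega))

theorem mem_of_len_one {J : Set W} (hJ : J ⊆ S) {u : W} (hu : u ∈ Subgroup.closure J)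
    (h : wordLen S u = 1) : u ∈ J := by
  obtain ⟨L, k1, rfl, k3⟩ := C.exists_red hJ hu
  rw [h, List.length_eq_one_iff] at k3
  obtain ⟨a, rfl⟩ := k3
  simpa using k1

theorem mem_S {J : Set W} (hJ : J ⊆ S) {s : W} (hs : s ∈ S) (hu : s ∈ Subgroup.closure J) : s ∈ J :=
  C.mem_of_len_one hJ hu (C.len_S hs)

theorem len_notin {J : Set W} (hJ : J ⊆ S) {s : W} (hs : s ∈ S) (hsJ : s ∉ J) {u : W}
    (hu : u ∈ Subgroup.closure J) : wordLen S (s * u) = wordLen S u + 1 := by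
  rcases C.len_s_cases hs u with h | h
  · exact h
  · obtain ⟨L, k1, rfl, k3⟩ := C.exists_red hJ hu
    obtain ⟨M, m1, m2, m3⟩ := C.exchange1 hs L (fun x hx => hJ (k1 x hx)) (by omega)
    exfalso; apply hsJ
    apply C.mem_S hJ hs
    rw [eq_mul_inv_of_mul_eq m3]
    refine Subgroup.mul_mem _ (Subgroup.list_prod_mem _ fun x hx =>
      Subgroup.subset_closure (k1 x (m1.subset hx))) (Subgroup.inv_mem _ hu)

theorem min_add {J : Set W} (hJ : J ⊆ S) {x : W}
    (hx : ∀ u ∈ Subgroup.closure J, wordLen S x ≤ wordLen S (u * x)) {u : W}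
    (hu : u ∈ Subgroup.closure J) : wordLen S (u * x) = wordLen S u + wordLen S x := by
  refine C.J_ind hJ (p := fun u => wordLen S (u * x) = wordLen S u + wordLen S x)
    ?_ ?_ hu
  · simp [len_one]
  · intro s hs u hu hl ih
    rw [mul_assoc]
    rcases C.len_s_cases (hJ hs) (u * x) with h | h
    · omega
    · exfalso
      obtain ⟨x', h1, h2⟩ := C.exchange2 (hJ hs) (u := u) (v := x) (by omega) (by omega)
      have : x' = (u⁻¹ * s * u) * x := by rw [← mul_right_inj u, ← h2]; group
      have h3 := hx (u⁻¹ * s * u) (mul_mem (mul_mem (inv_mem hu) (Subgroup.subset_closure hs)) hu)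
      rw [← this] at h3
      omega

theorem left_add {J : Set W} (hJ : J ⊆ S) {x : W}
    (hx : ∀ s ∈ J, wordLen S x < wordLen S (s * x)) {u : W}
    (hu : u ∈ Subgroup.closure J) : wordLen S (u * x) = wordLen S u + wordLen S x := by
  have hne : {n | ∃ u ∈ Subgroup.closure J, n = wordLen S (u * x)}.Nonempty :=
    ⟨_, 1, one_mem _, rfl⟩
  obtain ⟨v, hv, hv2⟩ := Nat.sInf_mem hne
  have hmin : ∀ u ∈ Subgroup.closure J, wordLen S (v * x) ≤ wordLen S (u * (v * x)) := by
    intro u hu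
    rw [← hv2]
    exact Nat.sInf_le ⟨u * v, mul_mem hu hv, by rw [mul_assoc]⟩
  have key := C.min_add hJ hmin (inv_mem hv)
  simp only [inv_mul_cancel_left] at key
  obtain ⟨L, k1, k2, k3⟩ := C.exists_red hJ (inv_mem hv)
  have hv1 : v = 1 := by
    cases L with
    | nil => simpa using k2.symm
    | cons t L =>
      exfalso
      have ht : t ∈ J := k1 t (by simp)
      have h1 := hx t ht
      have e : v⁻¹ = t * L.prod := by rw [← k2]; simp
      have h2 : t * x = L.prod * (v * x) := by
        have : x = v⁻¹ * (v * x) := by group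
        nth_rw 1 [this]
        rw [e, mul_assoc, C.ss (hJ ht)]
      have h3 := C.len_mul L.prod (v * x)
      have h4 := wl_le (S := S) L (fun x hx => hJ (k1 x (by simp [hx])))
      rw [← h2] at h3
      simp at k3
      rw [C.len_inv] at key k3
      omega
  subst hv1
  exact C.min_add hJ (by simpa using hmin) hu

theorem right_add {J : Set W} (hJ : J ⊆ S) {x : W}
    (hx : ∀ s ∈ J, wordLen S x < wordLen S (x * s)) {u : W}
    (hu : u ∈ Subgroup.closure J) : wordLen S (x * u) = wordLen S x + wordLen S u := by
  have := C.left_add hJ (x := x⁻¹) (fun s hs => by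
    rw [← C.len_mul_s (hJ hs), C.len_inv]; exact hx s hs) (inv_mem hu)
  rw [← mul_inv_rev, C.len_inv, C.len_inv, C.len_inv] at this
  omega

theorem desc {J : Set W} (hJ : J ⊆ S) {w : W}
    (hw : ∀ s ∈ J, wordLen S (s * w) < wordLen S w) {u : W}
    (hu : u ∈ Subgroup.closure J) : wordLen S (u⁻¹ * w) + wordLen S u = wordLen S w := by
  refine C.J_ind hJ (p := fun u => wordLen S (u⁻¹ * w) + wordLen S u = wordLen S w)
    ?_ ?_ hu
  · simp [len_one]
  · intro s hs u hu hl ih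
    have e : w = u * (u⁻¹ * w) := by group
    obtain ⟨x', h1, h2⟩ := C.exchange2 (hJ hs) (u := u) (v := u⁻¹ * w) (by omega)
      (by rw [← e]; exact hw s hs)
    rw [← e] at h2
    have h3 : (s * u)⁻¹ * w = x' := by
      rw [mul_inv_rev, C.sinv (hJ hs), mul_assoc, h2]; group
    rw [h3]
    have h4 := C.len_mul (s * u) x'
    rw [← h3] at h4
    rw [mul_inv_cancel_left, h3] at h4
    omega

end Cox
end comb
end S9

set_option linter.unusedSectionVars false

namespace S9
section luo
variable {W : Type*} [Group W] {S : Set W}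

theorem conj_closure {I I' : Set W} {a : W} (h : ∀ s ∈ I, a * s * a⁻¹ ∈ I') {u : W}
    (hu : u ∈ Subgroup.closure I) : a * u * a⁻¹ ∈ Subgroup.closure I' := by
  have : Subgroup.closure I ≤ (Subgroup.closure I').comap (MulAut.conj a).toMonoidHom := by
    rw [Subgroup.closure_le]
    intro s hs
    exact Subgroup.subset_closure (h s hs)
  exact this hu

def IsLng (S : Set W) (wl : Set W → W) : Prop :=
  ∀ J ⊆ S, wl J ∈ Subgroup.closure J ∧ ∀ u ∈ Subgroup.closure J, wordLen S u ≤ wordLen S (wl J)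

variable {wl : Set W → W} (C : Cox S) (H : IsLng S wl)
include C H
namespace IsLng

theorem desc {J : Set W} (hJ : J ⊆ S) {s : W} (hs : s ∈ J) :
    wordLen S (s * wl J) < wordLen S (wl J) := by
  have h1 := C.neq s (hJ hs) (wl J)
  have h2 := (H J hJ).2 (s * wl J) (mul_mem (Subgroup.subset_closure hs) (H J hJ).1)
  omega

theorem sub {J : Set W} (hJ : J ⊆ S) {u : W} (hu : u ∈ Subgroup.closure J) :
    wordLen S (u * wl J) + wordLen S u = wordLen S (wl J) := by
  have := C.desc hJ (fun s hs => desc C H hJ hs) (inv_mem hu)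
  rw [inv_inv, C.len_inv] at this
  exact this

theorem sq {J : Set W} (hJ : J ⊆ S) : wl J * wl J = 1 := by
  have := sub C H hJ (H J hJ).1
  exact C.len_zero (by omega)

theorem inv {J : Set W} (hJ : J ⊆ S) : (wl J)⁻¹ = wl J :=
  inv_eq_of_mul_eq_one_left (sq C H hJ)

theorem subr {J : Set W} (hJ : J ⊆ S) {u : W} (hu : u ∈ Subgroup.closure J) :
    wordLen S (wl J * u) + wordLen S u = wordLen S (wl J) := by
  have := sub C H hJ (inv_mem hu)
  rw [← inv C H hJ, ← mul_inv_rev, C.len_inv, C.len_inv, C.len_inv] at this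
  exact this

theorem uniq {J : Set W} (hJ : J ⊆ S) {v : W} (hv : v ∈ Subgroup.closure J)
    (h : wordLen S (wl J) ≤ wordLen S v) : v = wl J := by
  have h1 := sub C H hJ (inv_mem hv)
  rw [C.len_inv] at h1
  have := C.len_zero (u := v⁻¹ * wl J) (by omega)
  exact (inv_mul_eq_one.1 this)

/-- everything with all right descents is the longest element -/
theorem uniqS {v : W} (h : ∀ s ∈ S, wordLen S (v * s) < wordLen S v) : v = wl S := by
  have hm : ∀ x, x ∈ Subgroup.closure S := fun x => by rw [C.gen]; trivial
  have := C.desc (le_refl S) (w := v⁻¹) (fun s hs => by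
    rw [← C.len_mul_s hs, C.len_inv]; exact h s hs) (hm (wl S))
  rw [C.len_inv] at this
  exact uniq C H (le_refl S) (hm v) (by omega)

theorem conj_len {J : Set W} (hJ : J ⊆ S) {u : W} (hu : u ∈ Subgroup.closure J) :
    wordLen S (wl J * u * wl J) = wordLen S u := by
  have h1 := sub C H hJ (mul_mem (H J hJ).1 hu)
  have h2 := subr C H hJ hu
  omega

theorem conj_mem {J : Set W} (hJ : J ⊆ S) {s : W} (hs : s ∈ J) : wl J * s * wl J ∈ J := by
  have h := Subgroup.subset_closure hs
  refine C.mem_of_len_one hJ (mul_mem (mul_mem (H J hJ).1 h) (H J hJ).1) ?_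
  rw [conj_len C H hJ h, C.len_S (hJ hs)]

theorem conj_conj {J : Set W} (hJ : J ⊆ S) (u : W) : wl J * (wl J * u * wl J) * wl J = u := by
  have := sq C H hJ
  calc _ = (wl J * wl J) * u * (wl J * wl J) := by group
    _ = u := by rw [this]; simp

theorem conj_cl {J I I' : Set W} (hJ : J ⊆ S) (h : ∀ s ∈ I, wl J * s * wl J ∈ I') {u : W}
    (hu : u ∈ Subgroup.closure I) : wl J * u * wl J ∈ Subgroup.closure I' := by
  have := conj_closure (a := wl J) (I := I) (I' := I') (by rwa [inv C H hJ]) hu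
  rwa [inv C H hJ] at this

theorem conj_wl {J I I' : Set W} (hJ : J ⊆ S) (hI : I ⊆ J) (hI' : I' ⊆ J)
    (h : ∀ s ∈ I, wl J * s * wl J ∈ I') (h' : ∀ s ∈ I', wl J * s * wl J ∈ I) :
    wl J * wl I * wl J = wl I' := by
  have a := (H I (hI.trans hJ)).1
  have a' := (H I' (hI'.trans hJ)).1
  apply uniq C H (hI'.trans hJ) (conj_cl C H hJ h a)
  rw [conj_len C H hJ (Subgroup.closure_mono hI a),
    ← conj_len C H hJ (Subgroup.closure_mono hI' a')]
  exact (H I (hI.trans hJ)).2 _ (conj_cl C H hJ h' a')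

end IsLng
omit C H

structure Luo (S : Set W) (wl : Set W → W) (s : ℤ → W) : Prop where
  mem : ∀ n, s n ∈ S
  h01 : s 0 ≠ s 1
  hrec : ∀ n : ℤ, s (n + 1) = wl (S \ {s n}) * s (n - 1) * wl (S \ {s n})

abbrev JJ (S : Set W) (s : ℤ → W) (n : ℤ) : Set W := S \ {s n}
abbrev II (S : Set W) (s : ℤ → W) (n : ℤ) : Set W := S \ {s n, s (n + 1)}

theorem JS (S : Set W) (s : ℤ → W) (n : ℤ) : JJ S s n ⊆ S := Set.sdiff_subset
theorem IS (S : Set W) (s : ℤ → W) (n : ℤ) : II S s n ⊆ S := Set.sdiff_subset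
theorem IJ (S : Set W) (s : ℤ → W) (n : ℤ) : II S s n ⊆ JJ S s n := by
  intro x ⟨h1, h2⟩; refine ⟨h1, ?_⟩; simp at h2 ⊢; tauto
theorem IJ1 (S : Set W) (s : ℤ → W) (n : ℤ) : II S s n ⊆ JJ S s (n + 1) := by
  intro x ⟨h1, h2⟩; refine ⟨h1, ?_⟩; simp at h2 ⊢; tauto

/-- the elementary steps -/
def vv (S : Set W) (wl : Set W → W) (s : ℤ → W) (n : ℤ) : W := wl (II S s n) * wl (JJ S s (n + 1))

def xx (S : Set W) (wl : Set W → W) (s : ℤ → W) : ℕ → W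
  | 0 => 1
  | k + 1 => xx S wl s k * vv S wl s k

namespace Luo
variable {s : ℤ → W} (U : Luo S wl s)
include C H U

theorem hrec2 (n : ℤ) : s (n + 2) = wl (JJ S s (n + 1)) * s n * wl (JJ S s (n + 1)) := by
  have := U.hrec (n + 1)
  rw [show n + 1 + 1 = n + 2 by ring, show n + 1 - 1 = n by ring] at this
  exact this

theorem hrec2' (n : ℤ) : s n = wl (JJ S s (n + 1)) * s (n + 2) * wl (JJ S s (n + 1)) := by
  rw [hrec2 C H U, IsLng.conj_conj C H (JS S s _)]

theorem ne_step (n : ℤ) : s n ≠ s (n + 1) ↔ s (n + 1) ≠ s (n + 2) := by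
  constructor
  · intro h
    have : s n ∈ JJ S s (n + 1) := ⟨U.mem n, h⟩
    have := IsLng.conj_mem C H (JS S s _) this
    rw [← hrec2 C H U] at this
    exact fun h => this.2 h.symm
  · intro h
    have : s (n + 2) ∈ JJ S s (n + 1) := ⟨U.mem _, h.symm⟩
    have := IsLng.conj_mem C H (JS S s _) this
    rw [← hrec2' C H U] at this
    exact fun h => this.2 h

theorem ne (n : ℤ) : s n ≠ s (n + 1) := by
  induction n using Int.induction_on with
  | zero => simpa using U.h01
  | succ i ih =>
    have := (ne_step C H U _).1 ih
    rwa [show (i : ℤ) + 2 = i + 1 + 1 by ring] at this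
  | pred i ih =>
    have := (ne_step C H U (-(i : ℤ) - 1)).2
    rw [show -(i : ℤ) - 1 + 1 = -i by ring, show -(i : ℤ) - 1 + 2 = -i + 1 by ring] at this
    rw [show -(i : ℤ) - 1 + 1 = -i by ring]
    exact this ih

theorem I_conj (n : ℤ) {x : W} (hx : x ∈ II S s n) :
    wl (JJ S s (n + 1)) * x * wl (JJ S s (n + 1)) ∈ II S s (n + 1) := by
  have h := IsLng.conj_mem C H (JS S s _) (IJ1 S s n hx)
  refine ⟨h.1, ?_⟩
  rw [show n + 1 + 1 = n + 2 by ring]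
  rintro (h1 | h1)
  · exact h.2 h1
  · rw [Set.mem_singleton_iff, hrec2 C H U] at h1
    have : x = s n := by simpa using h1
    exact hx.2 (Or.inl this)

theorem I_conj' (n : ℤ) {x : W} (hx : x ∈ II S s (n + 1)) :
    wl (JJ S s (n + 1)) * x * wl (JJ S s (n + 1)) ∈ II S s n := by
  have h := IsLng.conj_mem C H (JS S s _) (IJ S s _ hx)
  refine ⟨h.1, ?_⟩
  rintro (h1 | h1)
  · rw [hrec2' C H U] at h1
    have : x = s (n + 2) := by simpa using h1
    exact hx.2 (Or.inr (by rw [show n + 1 + 1 = n + 2 by ring]; exact this))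
  · exact h.2 h1

theorem wI (n : ℤ) : wl (JJ S s (n + 1)) * wl (II S s n) * wl (JJ S s (n + 1))
    = wl (II S s (n + 1)) :=
  IsLng.conj_wl C H (JS S s _) (IJ1 S s n) (IJ S s _) (fun _ h => I_conj C H U n h)
    (fun _ h => I_conj' C H U n h)

theorem vv_eq (n : ℤ) : vv S wl s n = wl (JJ S s (n + 1)) * wl (II S s (n + 1)) := by
  rw [← wI C H U n, vv, ← mul_assoc, ← mul_assoc, IsLng.sq C H (JS S s _), one_mul]

theorem vv_mem (n : ℤ) : vv S wl s n ∈ Subgroup.closure (JJ S s (n + 1)) :=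
  mul_mem (Subgroup.closure_mono (IJ1 S s n) (H _ (IS S s n)).1) (H _ (JS S s _)).1

theorem vv_ne (n : ℤ) : 0 < wordLen S (vv S wl s n) := by
  by_contra h
  have h1 := C.len_zero (u := vv S wl s n) (by omega)
  have h2 : wl (II S s n) = wl (JJ S s (n + 1)) := by
    rw [vv] at h1
    rw [eq_inv_of_mul_eq_one_left h1, IsLng.inv C H (JS S s _)]
  have h3 : s n ∈ JJ S s (n + 1) := ⟨U.mem n, ne C H U n⟩
  have h4 := IsLng.desc C H (JS S s _) h3
  have h5 := C.len_notin (IS S s n) (U.mem n) (fun h => h.2 (Or.inl rfl)) (H _ (IS S s n)).1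
  rw [h2] at h5
  omega

theorem v_conj (n : ℤ) {x : W} (hx : x ∈ II S s (n + 1)) :
    vv S wl s n * x * (vv S wl s n)⁻¹ ∈ II S s n := by
  have h := IsLng.conj_mem C H (IS S s _) (I_conj' C H U n hx)
  rw [vv, mul_inv_rev, IsLng.inv C H (IS S s _), IsLng.inv C H (JS S s _)]
  simpa [mul_assoc] using h

theorem v_conj' (n : ℤ) {x : W} (hx : x ∈ II S s n) :
    (vv S wl s n)⁻¹ * x * vv S wl s n ∈ II S s (n + 1) := by
  have h := I_conj C H U n (IsLng.conj_mem C H (IS S s _) hx)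
  rw [vv, mul_inv_rev, IsLng.inv C H (IS S s _), IsLng.inv C H (JS S s _)]
  simpa [mul_assoc] using h

theorem x_conj (k : ℕ) : ∀ {x : W}, x ∈ II S s k →
    xx S wl s k * x * (xx S wl s k)⁻¹ ∈ II S s 0 := by
  induction k with
  | zero => intro x hx; simpa [xx] using hx
  | succ k ih =>
    intro x hx
    push_cast at hx
    have := ih (v_conj C H U k hx)
    simpa [xx, mul_assoc] using this

theorem x_conj' (k : ℕ) : ∀ {x : W}, x ∈ II S s 0 →
    (xx S wl s k)⁻¹ * x * xx S wl s k ∈ II S s k := by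
  induction k with
  | zero => intro x hx; simpa [xx] using hx
  | succ k ih =>
    intro x hx
    have := v_conj' C H U k (ih hx)
    push_cast
    simpa [xx, mul_assoc] using this

def NR (S : Set W) (I : Set W) (x : W) : Prop := ∀ t ∈ I, wordLen S x < wordLen S (x * t)

theorem NR_left (k : ℕ) (h : NR S (II S s k) (xx S wl s k)) :
    ∀ t ∈ II S s 0, wordLen S (xx S wl s k) < wordLen S (t * xx S wl s k) := by
  intro t ht
  have := h _ (x_conj' C H U k ht)
  rwa [show xx S wl s k * ((xx S wl s k)⁻¹ * t * xx S wl s k) = t * xx S wl s k by group] at this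

/-- `y_k = x_k w_{I_k} = w_{I_0} x_k` -/
theorem y_eq (k : ℕ) : xx S wl s k * wl (II S s k) = wl (II S s 0) * xx S wl s k := by
  induction k with
  | zero => simp [xx]
  | succ k ih =>
    have e : vv S wl s k * wl (II S s (k + 1)) = wl (II S s k) * vv S wl s k := by
      rw [vv_eq C H U, mul_assoc, IsLng.sq C H (IS S s (k + 1)), ← vv_eq C H U, vv, ← mul_assoc,
        IsLng.sq C H (IS S s k), mul_one, one_mul]
    push_cast
    rw [xx, mul_assoc, e, ← mul_assoc, ih, mul_assoc]

theorem x_step (k : ℕ) (h1 : NR S (II S s k) (xx S wl s k)) (h2 : wordLen S (xx S wl s k) <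
    wordLen S (xx S wl s k * s k)) :
    wordLen S (xx S wl s (k + 1)) = wordLen S (xx S wl s k) + wordLen S (vv S wl s k) ∧
    NR S (II S s (k + 1)) (xx S wl s (k + 1)) ∧
    ∀ t ∈ JJ S s (k + 1), wordLen S (xx S wl s (k + 1) * wl (II S s (k + 1)) * t) <
      wordLen S (xx S wl s (k + 1) * wl (II S s (k + 1))) := by
  have add : ∀ u ∈ Subgroup.closure (JJ S s (k + 1)),
      wordLen S (xx S wl s k * u) = wordLen S (xx S wl s k) + wordLen S u := by
    intro u hu
    refine C.right_add (JS S s (k + 1)) ?_ hu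
    intro t ht
    by_cases e : t = s k
    · rw [e]; exact h2
    · exact h1 t ⟨ht.1, by rintro (h | h); exacts [e h, ht.2 h]⟩
  have hv := vv_mem C H U k
  refine ⟨add _ hv, ?_, ?_⟩
  · intro t ht
    have htc : t ∈ Subgroup.closure (JJ S s (k + 1)) := Subgroup.subset_closure (IJ S s _ ht)
    rw [xx, mul_assoc, add _ hv, add _ (mul_mem hv htc)]
    have hi : wl (II S s (k + 1)) ∈ Subgroup.closure (II S s (k + 1)) := (H _ (IS S s _)).1
    have ht' := Subgroup.subset_closure ht
    have hm := Subgroup.closure_mono (IJ S s (k + 1))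
    have a1 := IsLng.subr C H (JS S s (k + 1)) (hm (mul_mem hi ht'))
    have a2 := IsLng.subr C H (JS S s (k + 1)) (hm hi)
    have a3 := IsLng.subr C H (IS S s (k + 1)) ht'
    rw [C.len_S ht.1] at a3
    rw [vv_eq C H U, mul_assoc]
    omega
  · intro t ht
    have htc : t ∈ Subgroup.closure (JJ S s (k + 1)) := Subgroup.subset_closure ht
    have e : xx S wl s (k + 1) * wl (II S s (k + 1)) = xx S wl s k * wl (JJ S s (k + 1)) := by
      rw [xx, vv_eq C H U]
      simp [mul_assoc, IsLng.sq C H (IS S s (k + 1))]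
    have hj : wl (JJ S s (k + 1)) ∈ Subgroup.closure (JJ S s (k + 1)) := (H _ (JS S s _)).1
    rw [e, mul_assoc, add _ hj, add _ (mul_mem hj htc)]
    have a3 := IsLng.subr C H (JS S s (k + 1)) htc
    rw [C.len_S ht.1] at a3
    omega

/-- the invariant along the gallery -/
theorem x_inv (k : ℕ) (h : ∀ j < k, xx S wl s j * wl (II S s j) ≠ wl S) :
    (∀ j < k, wordLen S (xx S wl s (j + 1)) = wordLen S (xx S wl s j) + wordLen S (vv S wl s j)) ∧
    NR S (II S s k) (xx S wl s k) ∧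
    (k ≠ 0 → ∀ t ∈ JJ S s k, wordLen S (xx S wl s k * wl (II S s k) * t) <
      wordLen S (xx S wl s k * wl (II S s k))) := by
  induction k with
  | zero =>
    refine ⟨by simp, ?_, by simp⟩
    intro t ht
    rw [xx, one_mul, len_one, C.len_S ht.1]; omega
  | succ k ih =>
    obtain ⟨a1, a2, a3⟩ := ih (fun j hj => h j (by omega))
    have key : wordLen S (xx S wl s k) < wordLen S (xx S wl s k * s k) := by
      by_contra hn
      have hlt : wordLen S (xx S wl s k * s k) < wordLen S (xx S wl s k) := by
        have := C.neq (s k) (U.mem k) (xx S wl s k)⁻¹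
        rw [← C.len_mul_s (U.mem k), C.len_inv] at this
        omega
      have hk : k ≠ 0 := by
        rintro rfl
        simp [xx, len_one] at hlt
      apply h k (by omega)
      apply IsLng.uniqS C H
      intro t ht
      by_cases e : t = s k
      · subst e
        have b1 := C.left_add (IS S s 0) (NR_left C H U k a2) (H _ (IS S s 0)).1
        rw [y_eq C H U, mul_assoc]
        have b2 := C.len_mul (wl (II S s 0)) (xx S wl s k * s k)
        omega
      · exact a3 hk t ⟨ht, e⟩
    obtain ⟨b1, b2, b3⟩ := x_step C H U k a2 key
    refine ⟨fun j hj => ?_, by push_cast; exact b2, fun _ => by push_cast; exact b3⟩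
    rcases Nat.lt_succ_iff_lt_or_eq.1 hj with hj | rfl
    · exact a1 j hj
    · exact b1

theorem exists_m [Finite W] : ∃ m : ℕ, 0 < m ∧ xx S wl s m * wl (II S s m) = wl S ∧
    ∀ j < m, xx S wl s j * wl (II S s j) ≠ wl S := by
  have hex : ∃ m : ℕ, xx S wl s m * wl (II S s m) = wl S := by
    by_contra hcon
    push Not at hcon
    have hlen : ∀ k : ℕ, k ≤ wordLen S (xx S wl s k) := by
      intro k
      induction k with
      | zero => omega
      | succ k ih =>
        have := (x_inv C H U (k + 1) (fun j _ => hcon j)).1 k (by omega)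
        have := vv_ne C H U k
        omega
    have := hlen (wordLen S (wl S) + 1)
    have := (H S le_rfl).2 (xx S wl s (wordLen S (wl S) + 1)) (by rw [C.gen]; trivial)
    omega
  classical
  refine ⟨Nat.find hex, ?_, Nat.find_spec hex, fun j hj => Nat.find_min hex hj⟩
  rw [Nat.pos_iff_ne_zero]
  intro h0
  have h := Nat.find_spec hex
  rw [h0] at h
  simp only [xx, one_mul, Nat.cast_zero] at h
  have h4 := IsLng.desc C H le_rfl (U.mem 0)
  have h5 := C.len_notin (IS S s 0) (U.mem 0) (fun h => h.2 (Or.inl rfl)) (H _ (IS S s 0)).1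
  rw [h] at h5
  omega

end Luo
end luo
end S9

namespace S9
section luo2
variable {W : Type*} [Group W] {S : Set W} {wl : Set W → W} (C : Cox S) (H : IsLng S wl)
variable {s : ℤ → W}

theorem sig_diff (C : Cox S) (H : IsLng S wl) (A A' : Set W)
    (h : ∀ x, x ∈ A ↔ wl S * x * wl S ∈ A') :
    (∀ x ∈ S \ A, wl S * x * wl S ∈ S \ A') ∧ (∀ x ∈ S \ A', wl S * x * wl S ∈ S \ A) := by
  constructor
  · intro x hx
    exact ⟨IsLng.conj_mem C H le_rfl hx.1, fun h' => hx.2 ((h x).2 h')⟩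
  · intro x hx
    refine ⟨IsLng.conj_mem C H le_rfl hx.1, fun h' => hx.2 ?_⟩
    have := (h _).1 h'
    rwa [IsLng.conj_conj C H le_rfl] at this

theorem sig_wl (C : Cox S) (H : IsLng S wl) (A A' : Set W)
    (h : ∀ x, x ∈ A ↔ wl S * x * wl S ∈ A') :
    wl S * wl (S \ A) * wl S = wl (S \ A') :=
  IsLng.conj_wl C H le_rfl Set.sdiff_subset Set.sdiff_subset (sig_diff C H A A' h).1
    (sig_diff C H A A' h).2

theorem sig_inj {a x y : W} : a * x * a = a * y * a ↔ x = y := by simp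

theorem sig_wl1 (C : Cox S) (H : IsLng S wl) {a b : W} (h : b = wl S * a * wl S) :
    wl S * wl (S \ {a}) * wl S = wl (S \ {b}) :=
  sig_wl C H _ _ (fun x => by simp [h])

theorem sig_wl2 (C : Cox S) (H : IsLng S wl) {a b a' b' : W} (h : b = wl S * a * wl S)
    (h' : b' = wl S * a' * wl S) :
    wl S * wl (S \ {a, a'}) * wl S = wl (S \ {b, b'}) :=
  sig_wl C H _ _ (fun x => by simp [h, h'])

theorem luo_sig (C : Cox S) (H : IsLng S wl) (U : Luo S wl s) (m : ℤ)
    (h0 : s m = wl S * s 0 * wl S) (h1 : s (m + 1) = wl S * s 1 * wl S) (n : ℤ) :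
    s (n + m) = wl S * s n * wl S ∧ s (n + 1 + m) = wl S * s (n + 1) * wl S := by
  have hq := IsLng.sq C H (le_refl S)
  have cj : ∀ a b c : W, wl S * (a * b * c) * wl S =
      (wl S * a * wl S) * (wl S * b * wl S) * (wl S * c * wl S) := by
    intro a b c
    calc _ = wl S * a * 1 * b * 1 * c * wl S := by group
      _ = wl S * a * (wl S * wl S) * b * (wl S * wl S) * c * wl S := by rw [hq]
      _ = _ := by group
  induction n using Int.induction_on with
  | zero => simpa [add_comm] using ⟨h0, h1⟩
  | succ i ih =>
    refine ⟨ih.2, ?_⟩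
    have e := Luo.hrec2 C H U i
    have e' := Luo.hrec2 C H U (i + m)
    have w := sig_wl1 C H ih.2
    rw [show (i : ℤ) + 1 + 1 = i + 2 by ring, show (i : ℤ) + 2 + m = i + m + 2 by ring, e', e, cj,
      ← ih.1, show (i : ℤ) + m + 1 = i + 1 + m by ring, w]
  | pred i ih =>
    have e := Luo.hrec2' C H U (-i - 1)
    have e' := Luo.hrec2' C H U (-i - 1 + m)
    have a1 : -(i : ℤ) - 1 + 1 = -i := by ring
    have a2 : -(i : ℤ) - 1 + 2 = -i + 1 := by ring
    have a3 : -(i : ℤ) - 1 + m + 1 = -i + m := by ring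
    have a4 : -(i : ℤ) - 1 + m + 2 = -i + 1 + m := by ring
    rw [a1, a2] at e
    rw [a3, a4] at e'
    have w := sig_wl1 C H ih.1
    refine ⟨?_, by rw [a1]; exact ih.1⟩
    rw [e', e, cj, ← ih.2, w]

theorem luo_main [Finite W] (C : Cox S) (H : IsLng S wl) (U : Luo S wl s) :
    ∃ m : ℕ, 0 < m ∧ xx S wl s m * wl (II S s m) = wl S ∧ Luo.NR S (II S s m) (xx S wl s m) ∧
    (∀ j < m, wordLen S (xx S wl s (j + 1)) = wordLen S (xx S wl s j) + wordLen S (vv S wl s j)) ∧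
    (∀ n : ℤ, s (n + m) = wl S * s n * wl S) := by
  obtain ⟨m, hm, hy, hlt⟩ := Luo.exists_m C H U
  obtain ⟨a1, a2, -⟩ := Luo.x_inv C H U m hlt
  refine ⟨m, hm, hy, a2, a1, ?_⟩
  have hq := IsLng.sq C H (le_refl S)
  have hall : ∀ u, u ∈ Subgroup.closure S := fun u => by rw [C.gen]; trivial
  -- conjugation of x by w_S agrees, up to w_I, with conjugation by x_m
  have hx : xx S wl s m = wl (II S s 0) * wl S := by
    rw [Luo.y_eq C H U] at hy
    rw [← hy, ← mul_assoc, IsLng.sq C H (IS S s 0), one_mul]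
  have hI : ∀ x ∈ II S s 0, wl S * x * wl S ∈ II S s m := by
    intro x hx'
    have := Luo.x_conj' C H U m (IsLng.conj_mem C H (IS S s 0) hx')
    rw [hx, mul_inv_rev, IsLng.inv C H (IS S s 0), IsLng.inv C H le_rfl] at this
    have e : wl S * wl (II S s 0) * (wl (II S s 0) * x * wl (II S s 0)) * (wl (II S s 0) * wl S)
      = wl S * (wl (II S s 0) * (wl (II S s 0) * x * wl (II S s 0)) * wl (II S s 0)) * wl S := by
      group
    rwa [e, IsLng.conj_conj C H (IS S s 0)] at this
  have hmemσ : ∀ n : ℤ, wl S * s n * wl S ∈ S := fun n => IsLng.conj_mem C H le_rfl (U.mem n)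
  have cc := IsLng.conj_conj C H (le_refl S)
  -- {s m, s (m+1)} ⊆ σ {s 0, s 1}
  have hsub : ∀ x ∈ S, x ∉ II S s m → x = wl S * s 0 * wl S ∨ x = wl S * s 1 * wl S := by
    intro x hxS hxI
    by_contra hcon
    push Not at hcon
    apply hxI
    have : wl S * x * wl S ∈ II S s 0 := by
      refine ⟨IsLng.conj_mem C H le_rfl hxS, ?_⟩
      rintro (h | h)
      · apply hcon.1; rw [← h, cc]
      · apply hcon.2; rw [zero_add, Set.mem_singleton_iff] at h; rw [← h, cc]
    have := hI _ this
    rwa [cc] at this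
  have c0 := hsub (s m) (U.mem _) (fun h => h.2 (Or.inl rfl))
  have c1 := hsub (s (m + 1)) (U.mem _) (fun h => h.2 (Or.inr rfl))
  have hne := Luo.ne C H U m
  have h0 : s m ≠ wl S * s 1 * wl S := by
    intro hs
    obtain ⟨k, rfl⟩ : ∃ k, m = k + 1 := ⟨m - 1, by omega⟩
    push_cast at *
    have e : xx S wl s (k + 1) * wl (II S s (k + 1)) = xx S wl s k * wl (JJ S s (k + 1)) := by
      rw [xx, Luo.vv_eq C H U]
      simp [mul_assoc, IsLng.sq C H (IS S s (k + 1))]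
    have w := sig_wl1 C H hs
    have hxk : xx S wl s k = wl (JJ S s 1) * wl S := by
      have : xx S wl s k = wl S * wl (JJ S s (k + 1)) := by
        rw [← hy, e, mul_assoc, IsLng.sq C H (JS S s _), mul_one]
      rw [this, show JJ S s (k + 1) = S \ {s (k + 1)} from rfl, ← w]
      have : wl S * (wl S * wl (S \ {s 1}) * wl S) = (wl S * wl S) * wl (S \ {s 1}) * wl S := by
        group
      rw [this, hq, one_mul]
    rcases Nat.eq_zero_or_pos k with rfl | hk
    · rw [xx] at hxk
      have h2 : wl (JJ S s 1) = wl S := by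
        rw [eq_inv_of_mul_eq_one_left hxk.symm, IsLng.inv C H le_rfl]
      have h4 := IsLng.desc C H le_rfl (U.mem 1)
      have h5 := C.len_notin (JS S s 1) (U.mem 1) (fun h => h.2 rfl) (H _ (JS S s 1)).1
      rw [h2] at h5
      omega
    · have tri : ∀ j : ℕ, j + 1 ≤ k →
          wordLen S ((vv S wl s 0)⁻¹ * xx S wl s (j + 1)) + wordLen S (vv S wl s 0) ≤
            wordLen S (xx S wl s (j + 1)) := by
        intro j
        induction j with
        | zero => intro _; simp [xx, len_one]
        | succ j ih =>
          intro hj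
          have b1 := ih (by omega)
          have b2 := a1 (j + 1) (by omega)
          have b3 := C.len_mul ((vv S wl s 0)⁻¹ * xx S wl s (j + 1)) (vv S wl s ((j + 1 : ℕ) : ℤ))
          rw [mul_assoc] at b3
          rw [show xx S wl s (j + 1 + 1) =
            xx S wl s (j + 1) * vv S wl s ((j + 1 : ℕ) : ℤ) from rfl] at *
          omega
      have t := tri (k - 1) (by omega)
      rw [show k - 1 + 1 = k by omega, hxk] at t
      have vm := Luo.vv_mem C H U 0
      have vp := Luo.vv_ne C H U 0
      rw [zero_add] at vm
      have d1 := IsLng.sub C H (JS S s 1) (inv_mem vm)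
      have d2 := IsLng.sub C H le_rfl (hall (wl (JJ S s 1)))
      have d3 := IsLng.sub C H le_rfl (hall ((vv S wl s 0)⁻¹ * wl (JJ S s 1)))
      rw [C.len_inv] at d1
      rw [← mul_assoc] at t
      omega
  have e0 : s m = wl S * s 0 * wl S := c0.resolve_right h0
  have e1 : s (m + 1) = wl S * s 1 * wl S := c1.resolve_left (fun h => hne (e0.trans h.symm))
  exact fun n => (luo_sig C H U m e0 e1 n).1

theorem luo_shift (C : Cox S) (H : IsLng S wl) (U : Luo S wl s) (m : ℤ) :
    Luo S wl (fun n => s (n + m)) where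
  mem n := U.mem _
  h01 := by
    have := Luo.ne C H U m
    simpa [add_comm] using this
  hrec n := by
    have := U.hrec (n + m)
    rw [show n + m + 1 = n + 1 + m by ring, show n + m - 1 = n - 1 + m by ring] at this
    exact this

theorem sig_vv (C : Cox S) (H : IsLng S wl) {m : ℤ}
    (h : ∀ n : ℤ, s (n + m) = wl S * s n * wl S) (n : ℤ) :
    vv S wl (fun n => s (n + m)) n = wl S * vv S wl s n * wl S := by
  have hq := IsLng.sq C H (le_refl S)
  have e1 := sig_wl1 C H (h (n + 1))
  have e2 := sig_wl2 C H (h n) (h (n + 1))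
  rw [vv, vv]
  simp only [II, JJ]
  rw [← e1, ← e2]
  calc _ = wl S * wl (S \ {s n, s (n + 1)}) * (wl S * wl S) * wl (S \ {s (n + 1)}) * wl S := by
        group
    _ = _ := by rw [hq]; group

theorem sig_xx (C : Cox S) (H : IsLng S wl) {m : ℤ}
    (h : ∀ n : ℤ, s (n + m) = wl S * s n * wl S) (k : ℕ) :
    xx S wl (fun n => s (n + m)) k = wl S * xx S wl s k * wl S := by
  have hq := IsLng.sq C H (le_refl S)
  induction k with
  | zero => simp [xx, hq]
  | succ k ih =>
    rw [xx, xx, ih, sig_vv C H h]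
    calc _ = wl S * xx S wl s k * (wl S * wl S) * vv S wl s k * wl S := by group
      _ = _ := by rw [hq]; group

theorem sig_len (C : Cox S) (H : IsLng S wl) (u : W) :
    wordLen S (wl S * u * wl S) = wordLen S u :=
  IsLng.conj_len C H le_rfl (by rw [C.gen]; trivial)

/-- everything needed about one half turn -/
structure Half (S : Set W) (wl : Set W → W) (s : ℤ → W) (m : ℕ) : Prop where
  y : xx S wl s m * wl (II S s m) = wl S
  nr : Luo.NR S (II S s m) (xx S wl s m)
  add : ∀ j < m, wordLen S (xx S wl s (j + 1)) =
    wordLen S (xx S wl s j) + wordLen S (vv S wl s j)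

theorem luo_half [Finite W] (C : Cox S) (H : IsLng S wl) (U : Luo S wl s) :
    ∃ m : ℕ, 0 < m ∧ Half S wl s m ∧ Half S wl (fun n => s (n + m)) m ∧
      (∀ n : ℤ, s (n + m) = wl S * s n * wl S) := by
  obtain ⟨m, hm, h1, h2, h3, h4⟩ := luo_main C H U
  refine ⟨m, hm, ⟨h1, h2, h3⟩, ⟨?_, ?_, ?_⟩, h4⟩
  · have e := sig_wl2 C H (h4 m) (h4 (m + 1))
    have hq := IsLng.sq C H (le_refl S)
    rw [sig_xx C H h4]
    simp only [II] at h1 ⊢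
    rw [← e]
    calc _ = wl S * xx S wl s m * (wl S * wl S) * wl (S \ {s m, s (m + 1)}) * wl S := by group
      _ = wl S * (xx S wl s m * wl (S \ {s m, s (m + 1)})) * wl S := by rw [hq]; group
      _ = _ := by rw [h1, hq, one_mul]
  · intro t ht
    have ht' : wl S * t * wl S ∈ II S s m := by
      refine (sig_diff C H {s m, s (m + 1)} {s (m + m), s (m + 1 + m)} ?_).2 t ht
      intro x
      simp [h4]
    have := h2 _ ht'
    rw [sig_xx C H h4, sig_len C H, ← sig_len C H (wl S * xx S wl s m * wl S * t)]
    have hq := IsLng.sq C H (le_refl S)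
    have e : wl S * (wl S * xx S wl s m * wl S * t) * wl S
      = (wl S * wl S) * (xx S wl s m * (wl S * t * wl S)) := by group
    rw [e, hq, one_mul]
    exact this
  · intro j hj
    rw [sig_xx C H h4, sig_xx C H h4, sig_vv C H h4, sig_len C H, sig_len C H, sig_len C H]
    exact h3 j hj

end luo2
end S9

namespace S9
section bn
variable {G : Type*} [Group G] {B N : Subgroup G}

theorem mem_BwB {w : ↥N ⧸ (B ⊓ N).subgroupOf N} {g : G} :
    g ∈ BwB B N w ↔ ∃ b ∈ B, ∃ b' ∈ B, ∃ x : ↥N, QuotientGroup.mk x = w ∧ g = b * x * b' := by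
  constructor
  · intro h
    obtain ⟨a, ha, b', hb', rfl⟩ := Set.mem_mul.1 h
    obtain ⟨b, hb, y, ⟨x, hx, rfl⟩, rfl⟩ := Set.mem_mul.1 ha
    exact ⟨b, hb, b', hb', x, hx, rfl⟩
  · rintro ⟨b, hb, b', hb', x, hx, rfl⟩
    exact Set.mul_mem_mul (Set.mul_mem_mul hb ⟨x, hx, rfl⟩) hb'

theorem mem_BwB_mk {x : ↥N} {g : G} :
    g ∈ BwB B N (QuotientGroup.mk x) ↔ ∃ b ∈ B, ∃ b' ∈ B, g = b * x * b' := by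
  rw [mem_BwB]
  constructor
  · rintro ⟨b, hb, b', hb', y, hy, rfl⟩
    have h := QuotientGroup.eq.1 hy
    rw [Subgroup.mem_subgroupOf] at h
    have hB : ((y : G)⁻¹ * (x : G)) ∈ B := by simpa using h.1
    refine ⟨b, hb, ((y : G)⁻¹ * (x : G))⁻¹ * b', B.mul_mem (B.inv_mem hB) hb', ?_⟩
    group
  · rintro ⟨b, hb, b', hb', rfl⟩
    exact ⟨b, hb, b', hb', x, rfl, rfl⟩

theorem BwB_l {w : ↥N ⧸ (B ⊓ N).subgroupOf N} {b g : G} (hb : b ∈ B) (hg : g ∈ BwB B N w) :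
    b * g ∈ BwB B N w := by
  obtain ⟨b1, h1, b2, h2, x, hx, rfl⟩ := mem_BwB.1 hg
  exact mem_BwB.2 ⟨b * b1, B.mul_mem hb h1, b2, h2, x, hx, by group⟩

theorem BwB_r {w : ↥N ⧸ (B ⊓ N).subgroupOf N} {b g : G} (hb : b ∈ B) (hg : g ∈ BwB B N w) :
    g * b ∈ BwB B N w := by
  obtain ⟨b1, h1, b2, h2, x, hx, rfl⟩ := mem_BwB.1 hg
  exact mem_BwB.2 ⟨b1, h1, b2 * b, B.mul_mem h2 hb, x, hx, by group⟩

theorem BwB_ne (w : ↥N ⧸ (B ⊓ N).subgroupOf N) : ∃ g, g ∈ BwB B N w := by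
  obtain ⟨x, rfl⟩ := QuotientGroup.mk_surjective w
  exact ⟨x, mem_BwB_mk.2 ⟨1, B.one_mem, 1, B.one_mem, by simp⟩⟩

theorem BwB_sub {u v : ↥N ⧸ (B ⊓ N).subgroupOf N} {g h : G} (hu : g ∈ BwB B N u)
    (hv : g ∈ BwB B N v) (hh : h ∈ BwB B N u) : h ∈ BwB B N v := by
  obtain ⟨x, rfl⟩ := QuotientGroup.mk_surjective u
  obtain ⟨b1, h1, b2, h2, rfl⟩ := mem_BwB_mk.1 hu
  obtain ⟨c1, k1, c2, k2, rfl⟩ := mem_BwB_mk.1 hh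
  have := BwB_l (B.mul_mem k1 (B.inv_mem h1)) (BwB_r (B.mul_mem (B.inv_mem h2) k2) hv)
  convert this using 1
  group

variable [((B ⊓ N).subgroupOf N).Normal]

theorem BwB_one {g : G} : g ∈ BwB B N (1 : ↥N ⧸ (B ⊓ N).subgroupOf N) ↔ g ∈ B := by
  rw [← QuotientGroup.mk_one, mem_BwB_mk]
  constructor
  · rintro ⟨b, hb, b', hb', rfl⟩
    simpa using B.mul_mem hb hb'
  · intro h
    exact ⟨g, h, 1, B.one_mem, by simp⟩

theorem BwB_inv {w : ↥N ⧸ (B ⊓ N).subgroupOf N} {g : G} (hg : g ∈ BwB B N w) :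
    g⁻¹ ∈ BwB B N w⁻¹ := by
  obtain ⟨b1, h1, b2, h2, x, rfl, rfl⟩ := mem_BwB.1 hg
  exact mem_BwB.2 ⟨b2⁻¹, B.inv_mem h2, b1⁻¹, B.inv_mem h1, x⁻¹, by simp, by simp [mul_assoc]⟩

theorem BwB_fac {u v : ↥N ⧸ (B ⊓ N).subgroupOf N} {g : G} (hg : g ∈ BwB B N (u * v)) :
    ∃ a ∈ BwB B N u, ∃ b ∈ BwB B N v, g = a * b := by
  obtain ⟨x, rfl⟩ := QuotientGroup.mk_surjective u
  obtain ⟨y, rfl⟩ := QuotientGroup.mk_surjective v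
  rw [← QuotientGroup.mk_mul] at hg
  obtain ⟨b1, h1, b2, h2, rfl⟩ := mem_BwB_mk.1 hg
  exact ⟨b1 * x, mem_BwB_mk.2 ⟨b1, h1, 1, B.one_mem, by simp⟩, y * b2,
    mem_BwB_mk.2 ⟨1, B.one_mem, b2, h2, by simp⟩, by simp [mul_assoc]⟩

structure BNP (B N : Subgroup G) [((B ⊓ N).subgroupOf N).Normal]
    (S : Set (↥N ⧸ (B ⊓ N).subgroupOf N)) : Prop where
  gen : Subgroup.closure S = ⊤
  inv : ∀ s ∈ S, s * s = 1 ∧ s ≠ 1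
  ax1 : ∀ s ∈ S, ∀ w : ↥N ⧸ (B ⊓ N).subgroupOf N,
      lifts B N s * (B : Set G) * lifts B N w ⊆ BwB B N (s * w) ∪ BwB B N w
  ax2 : ∀ s ∈ S, ¬(lifts B N s * (B : Set G) * lifts B N s ⊆ (B : Set G))

namespace BNP
variable {S : Set (↥N ⧸ (B ⊓ N).subgroupOf N)} (A : BNP B N S)
include A

theorem inv' : ∀ s ∈ S, s * s = 1 := fun s hs => (A.inv s hs).1
theorem sinv {s} (hs : s ∈ S) : s⁻¹ = s := inv_eq_of_mul_eq_one_left (A.inv' s hs)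
theorem ss {s} (hs : s ∈ S) (w : ↥N ⧸ (B ⊓ N).subgroupOf N) : s * (s * w) = w := by
  rw [← mul_assoc, A.inv' s hs, one_mul]

theorem mulS {s w} (hs : s ∈ S) {g h : G} (hg : g ∈ BwB B N s) (hh : h ∈ BwB B N w) :
    g * h ∈ BwB B N (s * w) ∨ g * h ∈ BwB B N w := by
  obtain ⟨b1, h1, b2, h2, x, hx, rfl⟩ := mem_BwB.1 hg
  obtain ⟨c1, k1, c2, k2, y, hy, rfl⟩ := mem_BwB.1 hh
  have : (x : G) * (b2 * c1) * y ∈ lifts B N s * (B : Set G) * lifts B N w :=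
    Set.mul_mem_mul (Set.mul_mem_mul ⟨x, hx, rfl⟩ (B.mul_mem h2 k1)) ⟨y, hy, rfl⟩
  have e : b1 * x * b2 * (c1 * y * c2) = b1 * ((x : G) * (b2 * c1) * y) * c2 := by group
  rw [e]
  rcases A.ax1 s hs w this with h | h
  · exact Or.inl (BwB_r k2 (BwB_l h1 h))
  · exact Or.inr (BwB_r k2 (BwB_l h1 h))

theorem mulS' {s w} (hs : s ∈ S) {g h : G} (hg : g ∈ BwB B N w) (hh : h ∈ BwB B N s) :
    g * h ∈ BwB B N (w * s) ∨ g * h ∈ BwB B N w := by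
  have h1 := BwB_inv hh
  rw [A.sinv hs] at h1
  rcases A.mulS hs h1 (BwB_inv hg) with h | h
  · left; have := BwB_inv h; simpa [A.sinv hs] using this
  · right; have := BwB_inv h; simpa using this

theorem ex2 {s} (hs : s ∈ S) : ∃ g ∈ BwB B N s, ∃ h ∈ BwB B N s, g * h ∈ BwB B N s := by
  have := A.ax2 s hs
  rw [Set.not_subset] at this
  obtain ⟨z, hz, hzB⟩ := this
  obtain ⟨a, ha, b, ⟨y, hy, rfl⟩, rfl⟩ := Set.mem_mul.1 hz
  obtain ⟨c, ⟨x, hx, rfl⟩, d, hd, rfl⟩ := Set.mem_mul.1 ha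
  have e1 : (x : G) * d ∈ BwB B N s := mem_BwB.2 ⟨1, B.one_mem, d, hd, x, hx, by simp⟩
  have e2 : (y : G) ∈ BwB B N s := mem_BwB.2 ⟨1, B.one_mem, 1, B.one_mem, y, hy, by simp⟩
  refine ⟨_, e1, _, e2, ?_⟩
  rcases A.mulS hs e1 e2 with h | h
  · rw [A.inv' s hs, BwB_one] at h
    exact absurd h hzB
  · exact h

theorem first_letter {w : ↥N ⧸ (B ⊓ N).subgroupOf N} {n : ℕ} (h : wordLen S w = n + 1) :
    ∃ s ∈ S, ∃ v, w = s * v ∧ wordLen S v = n := by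
  obtain ⟨L, h1, h2, h3⟩ := exists_red' A.gen A.inv' w
  cases L with
  | nil => simp at h1; omega
  | cons s L =>
    have hs := h2 s (by simp)
    refine ⟨s, hs, L.prod, by simp [← h3], ?_⟩
    have a := wl_le (S := S) L (fun x hx => h2 x (by simp [hx]))
    have b := len_mul' A.gen A.inv' s L.prod
    have c := len_S_le hs
    rw [← List.prod_cons, h3] at b
    simp at h1
    omega

theorem last_letter {w : ↥N ⧸ (B ⊓ N).subgroupOf N} {n : ℕ} (h : wordLen S w = n + 1) :
    ∃ s ∈ S, ∃ v, w = v * s ∧ wordLen S v = n := by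
  rw [← len_inv' A.gen A.inv'] at h
  obtain ⟨s, hs, v, h1, h2⟩ := A.first_letter h
  refine ⟨s, hs, v⁻¹, ?_, by rw [len_inv' A.gen A.inv', h2]⟩
  rw [← inv_inj, h1]; simp [A.sinv hs]

theorem disj_aux (n : ℕ) : ∀ (u v : ↥N ⧸ (B ⊓ N).subgroupOf N) (g : G), wordLen S u = n →
    n ≤ wordLen S v → g ∈ BwB B N u → g ∈ BwB B N v → u = v := by
  induction n with
  | zero =>
    intro u v g h0 _ hu hv
    have := len_zero' A.gen A.inv' h0
    subst this
    rw [BwB_one] at hu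
    obtain ⟨x, rfl⟩ := QuotientGroup.mk_surjective v
    obtain ⟨b1, h1, b2, h2, rfl⟩ := mem_BwB_mk.1 hv
    symm
    rw [QuotientGroup.eq_one_iff, Subgroup.mem_subgroupOf]
    refine ⟨?_, x.2⟩
    have := B.mul_mem (B.mul_mem (B.inv_mem h1) hu) (B.inv_mem h2)
    have e : b1⁻¹ * (b1 * (x : G) * b2) * b2⁻¹ = (x : G) := by group
    rw [e] at this
    exact this
  | succ n ih =>
    intro u v g h0 hle hu hv
    obtain ⟨s, hs, u', rfl, hl⟩ := A.first_letter h0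
    obtain ⟨a, ha, y, hy, rfl⟩ := BwB_fac hu
    have ha' := BwB_inv ha
    rw [A.sinv hs] at ha'
    have := A.mulS hs ha' hv
    rw [inv_mul_cancel_left] at this
    rcases this with h | h
    · have l1 := len_mul' A.gen A.inv' s (s * v)
      rw [A.ss hs] at l1
      have l2 := len_S_le hs
      rw [ih u' _ y hl (by omega) hy h, A.ss hs]
    · have := ih u' v y hl (by omega) hy h
      subst this
      omega

theorem disj {u v : ↥N ⧸ (B ⊓ N).subgroupOf N} {g : G} (hu : g ∈ BwB B N u)
    (hv : g ∈ BwB B N v) : u = v := by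
  rcases le_total (wordLen S u) (wordLen S v) with h | h
  · exact A.disj_aux _ u v g rfl h hu hv
  · exact (A.disj_aux _ v u g rfl h hv hu).symm

theorem up_aux (n : ℕ) : ∀ (s w : ↥N ⧸ (B ⊓ N).subgroupOf N) (g h : G), s ∈ S → wordLen S w = n →
    n ≤ wordLen S (s * w) → g ∈ BwB B N s → h ∈ BwB B N w → g * h ∈ BwB B N (s * w) := by
  induction n with
  | zero =>
    intro s w g h hs h0 _ hg hh
    have := len_zero' A.gen A.inv' h0
    subst this
    rw [mul_one]
    exact BwB_r (BwB_one.1 hh) hg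
  | succ n ih =>
    intro s w g h hs h0 hle hg hh
    rcases A.mulS hs hg hh with h1 | h1
    · exact h1
    exfalso
    obtain ⟨t, ht, v, rfl, hl⟩ := A.last_letter h0
    obtain ⟨a, ha, b, hb, rfl⟩ := BwB_fac hh
    have l1 := len_mul' A.gen A.inv' (s * v) t
    have l2 := len_S_le ht
    rw [mul_assoc] at l1
    have k := ih s v g a hs hl (by omega) hg ha
    have hb' := BwB_inv hb
    rw [A.sinv ht] at hb'
    have := A.mulS' ht h1 hb'
    rw [mul_assoc v, A.inv' t ht, mul_one, show g * (a * b) * b⁻¹ = g * a by group] at this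
    rcases this with h2 | h2
    · have := A.disj k h2
      exact (A.inv s hs).2 (by simpa using this)
    · have := A.disj k h2
      rw [← this, A.ss hs] at hle
      omega

theorem up {s w : ↥N ⧸ (B ⊓ N).subgroupOf N} (hs : s ∈ S) (h : wordLen S w ≤ wordLen S (s * w))
    {g k : G} (hg : g ∈ BwB B N s) (hk : k ∈ BwB B N w) : g * k ∈ BwB B N (s * w) :=
  A.up_aux _ s w g k hs rfl h hg hk

theorem down {s w : ↥N ⧸ (B ⊓ N).subgroupOf N} (hs : s ∈ S)
    (h : wordLen S (s * w) ≤ wordLen S w) :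
    ∃ g ∈ BwB B N s, ∃ k ∈ BwB B N w, g * k ∈ BwB B N w := by
  obtain ⟨a, ha, b, hb, hab⟩ := A.ex2 hs
  obtain ⟨c, hc⟩ := BwB_ne (s * w)
  have h' : wordLen S (s * w) ≤ wordLen S (s * (s * w)) := by rwa [A.ss hs]
  have k1 := A.up hs h' hb hc
  have k2 := A.up hs h' hab hc
  rw [A.ss hs] at k1 k2
  exact ⟨a, ha, _, k1, by rwa [← mul_assoc]⟩

theorem cox : Cox S where
  gen := A.gen
  inv := A.inv'
  ne1 s hs := (A.inv s hs).2
  neq s hs w h := by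
    obtain ⟨g, hg, k, hk, hgk⟩ := A.down hs h.le
    have := A.disj (A.up hs h.ge hg hk) hgk
    exact (A.inv s hs).2 (by simpa using this)
  exch s hs t ht w h1 h2 := by
    obtain ⟨g, hg, k, hk, hgk⟩ := A.down hs h2.le
    obtain ⟨a, ha, b, hb, rfl⟩ := BwB_fac hk
    have e := A.up hs h1.le hg ha
    have hb' := BwB_inv hb
    rw [A.sinv ht] at hb'
    have := A.mulS' ht hgk hb'
    rw [mul_assoc w, A.inv' t ht, mul_one, show g * (a * b) * b⁻¹ = g * a by group] at this
    rcases this with h | h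
    · exact absurd (A.disj e h) (fun h => (A.inv s hs).2 (by simpa using h))
    · exact A.disj e h

theorem add_set {u v : ↥N ⧸ (B ⊓ N).subgroupOf N}
    (h : wordLen S (u * v) = wordLen S u + wordLen S v) {g k : G} (hg : g ∈ BwB B N u)
    (hk : k ∈ BwB B N v) : g * k ∈ BwB B N (u * v) := by
  have C := A.cox
  have main := C.J_ind (le_refl S) (p := fun u => wordLen S (u * v) = wordLen S u + wordLen S v →
    ∀ g ∈ BwB B N u, g * k ∈ BwB B N (u * v)) ?_ ?_ (u := u) (by rw [C.gen]; trivial)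
  · exact main h g hg
  · intro _ g hg
    rw [one_mul]
    exact BwB_l (BwB_one.1 hg) hk
  · intro s hs u _ hl ih hsu g hg
    obtain ⟨a, ha, b, hb, rfl⟩ := BwB_fac hg
    rw [mul_assoc] at hsu
    have l1 := C.len_mul u v
    have l2 := C.len_mul s (u * v)
    rw [C.len_S hs] at l2
    rw [mul_assoc, mul_assoc]
    exact A.up hs (by omega) ha (ih (by omega) b hb)

/-- left multiplication by a parabolic, at the level of sets -/
theorem mul_para {J : Set (↥N ⧸ (B ⊓ N).subgroupOf N)} (hJ : J ⊆ S) {w} {g h : G}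
    (hg : g ∈ para B N J) (hh : h ∈ BwB B N w) :
    ∃ u ∈ Subgroup.closure J, g * h ∈ BwB B N (u * w) := by
  obtain ⟨u, hu, hgu⟩ := hg
  have C := A.cox
  have main := C.J_ind hJ (p := fun u => ∀ g ∈ BwB B N u,
    ∃ u ∈ Subgroup.closure J, g * h ∈ BwB B N (u * w)) ?_ ?_ hu
  · exact main g hgu
  · intro g hg
    exact ⟨1, one_mem _, by rw [one_mul]; exact BwB_l (BwB_one.1 hg) hh⟩
  · intro s hs u _ hl ih g hg
    obtain ⟨a, ha, b, hb, rfl⟩ := BwB_fac hg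
    obtain ⟨u', hu', h'⟩ := ih b hb
    rw [mul_assoc]
    rcases A.mulS (hJ hs) ha h' with h | h
    · exact ⟨s * u', mul_mem (Subgroup.subset_closure hs) hu', by rwa [mul_assoc]⟩
    · exact ⟨u', hu', h⟩

theorem para_inv {J : Set (↥N ⧸ (B ⊓ N).subgroupOf N)} {g : G}
    (hg : g ∈ para B N J) : g⁻¹ ∈ para B N J := by
  obtain ⟨u, hu, h⟩ := hg
  exact ⟨u⁻¹, inv_mem hu, BwB_inv h⟩

theorem para_mul {J : Set (↥N ⧸ (B ⊓ N).subgroupOf N)} (hJ : J ⊆ S) {g h : G}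
    (hg : g ∈ para B N J) (hh : h ∈ para B N J) : g * h ∈ para B N J := by
  obtain ⟨u, hu, h'⟩ := hh
  obtain ⟨u', hu', k⟩ := A.mul_para hJ hg h'
  exact ⟨_, mul_mem hu' hu, k⟩

theorem mul_para' {J : Set (↥N ⧸ (B ⊓ N).subgroupOf N)} (hJ : J ⊆ S) {w} {g h : G}
    (hg : g ∈ para B N J) (hh : h ∈ BwB B N w) :
    ∃ u ∈ Subgroup.closure J, h * g ∈ BwB B N (w * u) := by
  obtain ⟨u, hu, k⟩ := A.mul_para hJ (A.para_inv hg) (BwB_inv hh)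
  exact ⟨u⁻¹, inv_mem hu, by have := BwB_inv k; simpa using this⟩

def paraSub {J : Set (↥N ⧸ (B ⊓ N).subgroupOf N)} (hJ : J ⊆ S) : Subgroup G where
  carrier := para B N J
  mul_mem' := fun h1 h2 => A.para_mul hJ h1 h2
  one_mem' := ⟨1, one_mem _, BwB_one.2 B.one_mem⟩
  inv_mem' := fun h => A.para_inv h

end BNP
end bn
end S9

namespace S9
section alg
variable {G : Type*} [Group G] [Fintype G]

noncomputable def sm (X : Set G) : MonoidAlgebra ℂ G :=
  ∑ x ∈ (Set.toFinite X).toFinset, MonoidAlgebra.single x (1 : ℂ)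

theorem sm_mul (X Y Z : Set G) (K : Subgroup G)
    (hX : ∀ x ∈ X, ∀ k ∈ K, x * k ∈ X) (hY : ∀ y ∈ Y, ∀ k ∈ K, k * y ∈ Y)
    (hZ : ∀ x ∈ X, ∀ y ∈ Y, x * y ∈ Z) (hs : ∀ z ∈ Z, ∃ x ∈ X, ∃ y ∈ Y, z = x * y)
    (hu : ∀ x ∈ X, ∀ y ∈ Y, ∀ x' ∈ X, ∀ y' ∈ Y, x * y = x' * y' → x⁻¹ * x' ∈ K) :
    sm X * sm Y = (Nat.card K : ℂ) • sm Z := by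
  classical
  unfold sm
  rw [Finset.sum_mul_sum, ← Finset.sum_product', Finset.smul_sum,
    ← Finset.sum_fiberwise_of_maps_to (g := fun p : G × G => p.1 * p.2)
      (t := (Set.toFinite Z).toFinset)]
  · apply Finset.sum_congr rfl
    intro z hz
    have hz' : z ∈ Z := by simpa using hz
    obtain ⟨x0, hx0, y0, hy0, rfl⟩ := hs z hz'
    have e : (Finset.filter (fun p : G × G => p.1 * p.2 = x0 * y0)
        ((Set.toFinite X).toFinset ×ˢ (Set.toFinite Y).toFinset)) =
        (Finset.univ : Finset K).image (fun k : K => (x0 * (k : G), (k : G)⁻¹ * y0)) := by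
      ext ⟨a, b⟩
      simp only [Finset.mem_filter, Finset.mem_product, Set.Finite.mem_toFinset, Finset.mem_image,
        Finset.mem_univ, true_and, Prod.mk.injEq]
      constructor
      · rintro ⟨⟨ha, hb⟩, h⟩
        refine ⟨⟨x0⁻¹ * a, hu x0 hx0 y0 hy0 a ha b hb h.symm⟩, by simp, ?_⟩
        simp only [mul_inv_rev, inv_inv]
        rw [mul_assoc, ← h]; group
      · rintro ⟨k, rfl, rfl⟩
        refine ⟨⟨hX _ hx0 _ k.2, hY _ hy0 _ (K.inv_mem k.2)⟩, by group⟩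
    rw [e, Finset.sum_image]
    · simp only [MonoidAlgebra.single_mul_single, mul_one]
      rw [Finset.sum_congr rfl (g := fun _ => MonoidAlgebra.single (x0 * y0) (1 : ℂ))]
      · rw [Finset.sum_const, Finset.card_univ, Nat.card_eq_fintype_card, Nat.cast_smul_eq_nsmul]
      · intro k _
        congr 1
        group
    · intro k _ k' _ h
      have := (Prod.mk.injEq _ _ _ _ ▸ h).1
      exact Subtype.ext (by simpa using this)
  · rintro ⟨a, b⟩ h
    simp only [Finset.mem_product, Set.Finite.mem_toFinset] at h ⊢
    exact hZ a h.1 b h.2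

noncomputable def aug : MonoidAlgebra ℂ G →ₐ[ℂ] ℂ := MonoidAlgebra.lift ℂ ℂ G 1

theorem aug_sm (X : Set G) : aug (sm X) = (X.ncard : ℂ) := by
  unfold sm aug
  rw [map_sum]
  simp [MonoidAlgebra.lift_single, Set.ncard_eq_toFinset_card X]

variable {B N : Subgroup G}

noncomputable def TT (B N : Subgroup G) (w : ↥N ⧸ (B ⊓ N).subgroupOf N) : MonoidAlgebra ℂ G :=
  (Nat.card B : ℂ)⁻¹ • sm (BwB B N w)

variable [((B ⊓ N).subgroupOf N).Normal]

noncomputable def EE (B N : Subgroup G) [((B ⊓ N).subgroupOf N).Normal]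
    (I : Set (↥N ⧸ (B ⊓ N).subgroupOf N)) : MonoidAlgebra ℂ G :=
  ((para B N I).ncard : ℂ)⁻¹ • sm (para B N I)

theorem cB : (Nat.card B : ℂ) ≠ 0 := Nat.cast_ne_zero.2 Nat.card_pos.ne'

variable {S : Set (↥N ⧸ (B ⊓ N).subgroupOf N)} 

theorem uniq_up (A : BNP B N S) {s v : ↥N ⧸ (B ⊓ N).subgroupOf N} (hs : s ∈ S)
    (hl : wordLen S v < wordLen S (s * v)) {g g' h h' : G} (hg : g ∈ BwB B N s)
    (hg' : g' ∈ BwB B N s) (hh : h ∈ BwB B N v) (hh' : h' ∈ BwB B N v) (e : g * h = g' * h') :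
    g⁻¹ * g' ∈ B := by
  have h1 := BwB_inv hg
  rw [A.sinv hs] at h1
  rcases A.mulS hs h1 hg' with h2 | h2
  · rw [A.inv' s hs, BwB_one] at h2; exact h2
  · have h3 := A.up hs hl.le h2 hh'
    rw [mul_assoc, ← e, inv_mul_cancel_left] at h3
    have := A.disj hh h3
    exact absurd this (fun h => (A.inv s hs).2 (by simpa using h))

theorem uniq_add (A : BNP B N S) {u v : ↥N ⧸ (B ⊓ N).subgroupOf N}
    (hl : wordLen S (u * v) = wordLen S u + wordLen S v) {g g' h h' : G} (hg : g ∈ BwB B N u)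
    (hg' : g' ∈ BwB B N u) (hh : h ∈ BwB B N v) (hh' : h' ∈ BwB B N v) (e : g * h = g' * h') :
    g⁻¹ * g' ∈ B := by
  have C := A.cox
  have main := C.J_ind (le_refl S) (p := fun u => wordLen S (u * v) = wordLen S u + wordLen S v →
    ∀ g ∈ BwB B N u, ∀ g' ∈ BwB B N u, g * h = g' * h' → g⁻¹ * g' ∈ B) ?_ ?_ (u := u)
    (by rw [C.gen]; trivial)
  · exact main hl g hg g' hg' e
  · intro _ g hg g' hg' _
    exact B.mul_mem (B.inv_mem (BwB_one.1 hg)) (BwB_one.1 hg')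
  · intro s hs u _ hl ih hsu g hg g' hg' e
    obtain ⟨a, ha, b, hb, rfl⟩ := BwB_fac hg
    obtain ⟨a', ha', b', hb', rfl⟩ := BwB_fac hg'
    rw [mul_assoc] at hsu
    have l1 := C.len_mul u v
    have l2 := C.len_mul s (u * v)
    rw [C.len_S hs] at l2
    have hadd : wordLen S (u * v) = wordLen S u + wordLen S v := by omega
    have k := uniq_up A hs (v := u * v) (by omega) ha ha' (A.add_set hadd hb hh)
      (A.add_set hadd hb' hh') (by simpa [mul_assoc] using e)
    have := ih hadd b hb (a⁻¹ * a' * b') (BwB_l k hb') (by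
      have : b * h = a⁻¹ * (a * b * h) := by group
      rw [this, e]; group)
    convert this using 1
    group

theorem TT_mul (A : BNP B N S) {u v : ↥N ⧸ (B ⊓ N).subgroupOf N}
    (hl : wordLen S (u * v) = wordLen S u + wordLen S v) :
    TT B N u * TT B N v = TT B N (u * v) := by
  have := sm_mul (BwB B N u) (BwB B N v) (BwB B N (u * v)) B
    (fun x hx k hk => BwB_r hk hx) (fun x hx k hk => BwB_l hk hx)
    (fun x hx y hy => A.add_set hl hx hy) (fun z hz => BwB_fac hz)
    (fun x hx y hy x' hx' y' hy' e => uniq_add A hl hx hx' hy hy' e)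
  unfold TT
  rw [smul_mul_smul_comm, this, smul_smul]
  congr 1
  have := cB (B := B)
  field_simp

theorem para_card_ne (A : BNP B N S) {J : Set (↥N ⧸ (B ⊓ N).subgroupOf N)} (hJ : J ⊆ S) :
    ((para B N J).ncard : ℂ) ≠ 0 := by
  have h1 : (1 : G) ∈ para B N J := (A.paraSub hJ).one_mem
  exact Nat.cast_ne_zero.2 (Set.ncard_ne_zero_of_mem h1)

theorem EE_mul (A : BNP B N S) {J : Set (↥N ⧸ (B ⊓ N).subgroupOf N)} (hJ : J ⊆ S) :
    EE B N J * EE B N J = EE B N J := by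
  have hc := para_card_ne A hJ
  have := sm_mul (para B N J) (para B N J) (para B N J) (A.paraSub hJ)
    (fun x hx k hk => A.para_mul hJ hx hk) (fun x hx k hk => A.para_mul hJ hk hx)
    (fun x hx y hy => A.para_mul hJ hx hy)
    (fun z hz => ⟨1, (A.paraSub hJ).one_mem, z, hz, by simp⟩)
    (fun x hx y hy x' hx' y' hy' e => A.para_mul hJ (A.para_inv hx) hx')
  have hn : Nat.card (A.paraSub hJ) = (para B N J).ncard := rfl
  unfold EE
  rw [smul_mul_smul_comm, this, smul_smul, hn]
  congr 1
  field_simp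

def ZZ (B N : Subgroup G) [((B ⊓ N).subgroupOf N).Normal]
    (I : Set (↥N ⧸ (B ⊓ N).subgroupOf N)) (x : ↥N ⧸ (B ⊓ N).subgroupOf N) : Set G :=
  {g | ∃ u ∈ Subgroup.closure I, g ∈ BwB B N (u * x)}

/-- hypotheses on a conjugator -/
structure Cj (S I I' : Set (↥N ⧸ (B ⊓ N).subgroupOf N)) (x : ↥N ⧸ (B ⊓ N).subgroupOf N) :
    Prop where
  hI : I ⊆ S
  hI' : I' ⊆ S
  c : ∀ t ∈ I', x * t * x⁻¹ ∈ I
  c' : ∀ t ∈ I, x⁻¹ * t * x ∈ I'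
  nr : Luo.NR S I' x

namespace Cj
variable {I I' : Set (↥N ⧸ (B ⊓ N).subgroupOf N)} {x : ↥N ⧸ (B ⊓ N).subgroupOf N}
  (A : BNP B N S) (D : Cj S I I' x)
include A D

omit A in
theorem cl {u} (hu : u ∈ Subgroup.closure I') : x * u * x⁻¹ ∈ Subgroup.closure I :=
  conj_closure D.c hu

omit A in
theorem cl' {u} (hu : u ∈ Subgroup.closure I) : x⁻¹ * u * x ∈ Subgroup.closure I' := by
  have := conj_closure (a := x⁻¹) (I := I) (I' := I') (by simpa using D.c') hu
  simpa using this

theorem radd {u} (hu : u ∈ Subgroup.closure I') :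
    wordLen S (x * u) = wordLen S x + wordLen S u := A.cox.right_add D.hI' D.nr hu

theorem ladd {u} (hu : u ∈ Subgroup.closure I) :
    wordLen S (u * x) = wordLen S u + wordLen S x := by
  refine A.cox.left_add D.hI ?_ hu
  intro t ht
  have := D.nr _ (D.c' t ht)
  simpa [mul_assoc] using this

theorem L : sm (para B N I) * sm (BwB B N x) = (Nat.card B : ℂ) • sm (ZZ B N I x) := by
  have bp : ∀ b ∈ B, b ∈ para B N I := fun b hb => ⟨1, one_mem _, BwB_one.2 hb⟩
  apply sm_mul
  · exact fun p hp k hk => A.para_mul D.hI hp (bp k hk)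
  · exact fun p hp k hk => BwB_l hk hp
  · rintro p ⟨u, hu, hp⟩ y hy
    exact ⟨u, hu, A.add_set (D.ladd A hu) hp hy⟩
  · rintro z ⟨u, hu, hz⟩
    obtain ⟨a, ha, b, hb, rfl⟩ := BwB_fac hz
    exact ⟨a, ⟨u, hu, ha⟩, b, hb, rfl⟩
  · intro p hp y hy p' hp' y' hy' e
    obtain ⟨u, hu, h⟩ := A.para_mul D.hI (A.para_inv hp) hp'
    have k := A.add_set (D.ladd A hu) h hy'
    rw [mul_assoc, ← e, inv_mul_cancel_left] at k
    have := A.disj hy k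
    have hu1 : u = 1 := by simpa using this
    rw [hu1] at h
    exact BwB_one.1 h

theorem R : sm (BwB B N x) * sm (para B N I') = (Nat.card B : ℂ) • sm (ZZ B N I x) := by
  have bp : ∀ b ∈ B, b ∈ para B N I' := fun b hb => ⟨1, one_mem _, BwB_one.2 hb⟩
  apply sm_mul
  · exact fun p hp k hk => BwB_r hk hp
  · exact fun p hp k hk => A.para_mul D.hI' (bp k hk) hp
  · rintro y hy p ⟨u, hu, hp⟩
    have := A.add_set (D.radd A hu) hy hp
    exact ⟨_, D.cl hu, by simpa using this⟩
  · rintro z ⟨u, hu, hz⟩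
    have e : u * x = x * (x⁻¹ * u * x) := by group
    rw [e] at hz
    obtain ⟨a, ha, b, hb, rfl⟩ := BwB_fac hz
    exact ⟨a, ha, b, ⟨_, D.cl' hu, hb⟩, rfl⟩
  · intro y hy p hp y' hy' p' hp' e
    have e2 : y⁻¹ * y' = p * p'⁻¹ := by
      rw [inv_mul_eq_iff_eq_mul, ← mul_assoc, e]; group
    obtain ⟨u, hu, h⟩ := A.para_mul D.hI' hp (A.para_inv hp')
    rw [← e2] at h
    have k := A.add_set (D.radd A hu) hy h
    rw [mul_inv_cancel_left] at k
    have := A.disj hy' k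
    have hu1 : u = 1 := by simpa using this
    rw [hu1] at h
    exact BwB_one.1 h

theorem card_eq : ((para B N I).ncard : ℂ) = (para B N I').ncard := by
  have h := congrArg aug ((D.L A).trans (D.R A).symm)
  rw [map_mul, map_mul, aug_sm, aug_sm, aug_sm, mul_comm] at h
  obtain ⟨g, hg⟩ := BwB_ne x
  exact mul_left_cancel₀ (Nat.cast_ne_zero.2 (Set.ncard_ne_zero_of_mem hg)) h

theorem TE : TT B N x * EE B N I' = ((para B N I').ncard : ℂ)⁻¹ • sm (ZZ B N I x) := by
  unfold TT EE
  rw [smul_mul_smul_comm, D.R A, smul_smul]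
  congr 1
  have := cB (B := B)
  field_simp

theorem ET : EE B N I * TT B N x = TT B N x * EE B N I' := by
  rw [D.TE A, ← D.card_eq A]
  unfold TT EE
  rw [smul_mul_smul_comm, D.L A, smul_smul]
  congr 1
  have := cB (B := B)
  field_simp

theorem aP {w0} (hw0 : w0 ∈ Subgroup.closure I) :
    aPwQ B N (para B N I) (w0 * x) (para B N I') = TT B N x * EE B N I' := by
  rw [D.TE A]
  have e : para B N I * lifts B N (w0 * x) * para B N I' = ZZ B N I x := by
    ext g
    constructor
    · intro h
      obtain ⟨a, ha, q, hq, rfl⟩ := Set.mem_mul.1 h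
      obtain ⟨p, hp, y, ⟨n, hn, rfl⟩, rfl⟩ := Set.mem_mul.1 ha
      have hn' : (n : G) ∈ BwB B N (w0 * x) :=
        mem_BwB.2 ⟨1, B.one_mem, 1, B.one_mem, n, hn, by simp⟩
      obtain ⟨u, hu, h1⟩ := A.mul_para D.hI hp hn'
      obtain ⟨u', hu', h2⟩ := A.mul_para' D.hI' hq h1
      refine ⟨u * w0 * (x * u' * x⁻¹), mul_mem (mul_mem hu hw0) (D.cl hu'), ?_⟩
      convert h2 using 2
      group
    · rintro ⟨u, hu, h⟩
      have e : u * x = (u * w0⁻¹) * (w0 * x) := by group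
      rw [e] at h
      obtain ⟨a, ha, b, hb, rfl⟩ := BwB_fac h
      obtain ⟨b1, h1, b2, h2, n, hn, rfl⟩ := mem_BwB.1 hb
      have e2 : a * (b1 * n * b2) = a * b1 * n * b2 := by group
      rw [e2]
      refine Set.mul_mem_mul (Set.mul_mem_mul ?_ ⟨n, hn, rfl⟩) ?_
      · exact ⟨_, mul_mem hu (inv_mem hw0), BwB_r h1 ha⟩
      · exact ⟨1, one_mem _, BwB_one.2 h2⟩
  unfold aPwQ sm
  simp only [e]

end Cj
end alg
end S9

namespace S9
section fin
variable {G : Type*} [Group G] [Fintype G] {B N : Subgroup G} [((B ⊓ N).subgroupOf N).Normal]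
  {S : Set (↥N ⧸ (B ⊓ N).subgroupOf N)}
  {wl : Set (↥N ⧸ (B ⊓ N).subgroupOf N) → ↥N ⧸ (B ⊓ N).subgroupOf N}
  {s : ℤ → ↥N ⧸ (B ⊓ N).subgroupOf N}

theorem vv_cj (A : BNP B N S) (H : IsLng S wl) (U : Luo S wl s) (n : ℤ) :
    Cj S (II S s n) (II S s (n + 1)) (vv S wl s n) where
  hI := IS S s n
  hI' := IS S s (n + 1)
  c _ ht := Luo.v_conj A.cox H U n ht
  c' _ ht := Luo.v_conj' A.cox H U n ht
  nr := by
    have C := A.cox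
    intro t ht
    have hi : wl (II S s (n + 1)) ∈ Subgroup.closure (II S s (n + 1)) := (H _ (IS S s _)).1
    have ht' := Subgroup.subset_closure ht
    have hm := Subgroup.closure_mono (IJ S s (n + 1))
    have a1 := IsLng.subr C H (JS S s (n + 1)) (hm (mul_mem hi ht'))
    have a2 := IsLng.subr C H (JS S s (n + 1)) (hm hi)
    have a3 := IsLng.subr C H (IS S s (n + 1)) ht'
    have a4 := IsLng.subr C H (JS S s (n + 1)) (hm ht')
    rw [C.len_S ht.1] at a3
    have b1 := (H _ (JS S s (n + 1))).2 _ (hm hi)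
    have b2 := (H _ (JS S s (n + 1))).2 _ (hm (mul_mem hi ht'))
    have b3 := (H _ (IS S s (n + 1))).2 _ ht'
    rw [C.len_S ht.1] at b3
    rw [Luo.vv_eq C H U, mul_assoc]
    omega

noncomputable def aa (B N : Subgroup G) [((B ⊓ N).subgroupOf N).Normal]
    (S : Set (↥N ⧸ (B ⊓ N).subgroupOf N))
    (wl : Set (↥N ⧸ (B ⊓ N).subgroupOf N) → ↥N ⧸ (B ⊓ N).subgroupOf N)
    (s : ℤ → ↥N ⧸ (B ⊓ N).subgroupOf N) (n : ℤ) : MonoidAlgebra ℂ G :=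
  aPwQ B N (para B N (II S s n)) (wl (JJ S s (n + 1))) (para B N (II S s (n + 1)))

theorem aa_eq (A : BNP B N S) (H : IsLng S wl) (U : Luo S wl s) (n : ℤ) :
    aa B N S wl s n = TT B N (vv S wl s n) * EE B N (II S s (n + 1)) := by
  have := (vv_cj A H U n).aP A (H _ (IS S s n)).1
  rw [← this, aa, vv, ← mul_assoc, IsLng.sq A.cox H (IS S s n), one_mul]

theorem half_prod (A : BNP B N S) (H : IsLng S wl) (U : Luo S wl s) {m : ℕ}
    (F : Half S wl s m) (k : ℕ) (hk : k < m) :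
    ((List.range (k + 1)).map (fun i : ℕ => aa B N S wl s i)).prod =
      TT B N (xx S wl s (k + 1)) * EE B N (II S s (k + 1)) := by
  induction k with
  | zero => simp [xx, aa_eq A H U]
  | succ k ih =>
    have ih := ih (by omega)
    rw [List.range_succ, List.map_append, List.prod_append, ih]
    simp only [List.map_cons, List.map_nil, List.prod_cons, List.prod_nil, mul_one]
    rw [aa_eq A H U, mul_assoc, ← mul_assoc (EE _ _ _)]
    have e := (vv_cj A H U ((k + 1 : ℕ) : ℤ)).ET A
    push_cast at e ⊢
    rw [e, mul_assoc, EE_mul A (IS S s _), ← mul_assoc]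
    have := F.add (k + 1) hk
    rw [xx] at this
    push_cast at this
    rw [TT_mul A this]
    conv_rhs => rw [xx]
    push_cast
    rfl

theorem half_eq (A : BNP B N S) (H : IsLng S wl) (U : Luo S wl s) {m : ℕ} (hm : 0 < m)
    (F : Half S wl s m) :
    ((List.range m).map (fun i : ℕ => aa B N S wl s i)).prod =
      aPwQ B N (para B N (II S s 0)) (wl S) (para B N (II S s m)) := by
  have D : Cj S (II S s 0) (II S s m) (xx S wl s m) :=
    ⟨IS S s 0, IS S s m, fun _ ht => Luo.x_conj A.cox H U m ht,
      fun _ ht => Luo.x_conj' A.cox H U m ht, F.nr⟩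
  have e := D.aP A (H _ (IS S s 0)).1
  rw [← Luo.y_eq A.cox H U, F.y] at e
  rw [e]
  obtain ⟨k, rfl⟩ : ∃ k, m = k + 1 := ⟨m - 1, by omega⟩
  have := half_prod A H U F k (by omega)
  rw [this]
  push_cast
  rfl

theorem range_pow {M : Type*} [Monoid M] (f : ℕ → M) (c k : ℕ) (hf : ∀ i, f (c + i) = f i) :
    ((List.range c).map f).prod ^ k = ((List.range (c * k)).map f).prod := by
  induction k with
  | zero => simp
  | succ k ih =>
    rw [pow_succ', ih, show c * (k + 1) = c + c * k by ring, List.range_add, List.map_append,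
      List.prod_append, List.map_map]
    congr 3
    funext i
    simp [hf]

end fin
end S9

theorem stmt_9 [Fintype G] (B N : Subgroup G) [((B ⊓ N).subgroupOf N).Normal]
    -- BN-pair axioms
    (hGN : Subgroup.closure ((B : Set G) ∪ (N : Set G)) = ⊤)
    (S : Set (↥N ⧸ (B ⊓ N).subgroupOf N))
    (hSgen : Subgroup.closure S = ⊤)
    (hSinv : ∀ s ∈ S, s * s = 1 ∧ s ≠ 1)
    (hBN1 : ∀ s ∈ S, ∀ w : ↥N ⧸ (B ⊓ N).subgroupOf N,
      lifts B N s * (B : Set G) * lifts B N w ⊆ BwB B N (s * w) ∪ BwB B N w)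
    (hBN2 : ∀ s ∈ S, ¬(lifts B N s * (B : Set G) * lifts B N s ⊆ (B : Set G)))
    -- longest elements of the standard parabolic subgroups
    (wl : Set (↥N ⧸ (B ⊓ N).subgroupOf N) → ↥N ⧸ (B ⊓ N).subgroupOf N)
    (hwl : ∀ J ⊆ S, wl J ∈ Subgroup.closure J ∧
      ∀ u ∈ Subgroup.closure J, wordLen S u ≤ wordLen S (wl J))
    -- the Luo sequence generated by distinct s₀, s₁ ∈ S
    (s : ℤ → ↥N ⧸ (B ⊓ N).subgroupOf N)
    (hmem : ∀ n : ℤ, s n ∈ S) (h01 : s 0 ≠ s 1)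
    (hrec : ∀ n : ℤ, s (n + 1) = wl (S \ {s n}) * s (n - 1) * wl (S \ {s n}))
    -- c is the minimal positive period of the Luo sequence
    (c : ℕ) (hc : 0 < c) (hper : ∀ n : ℤ, s (n + c) = s n)
    (hminper : ∀ c' : ℕ, 0 < c' → (∀ n : ℤ, s (n + c') = s n) → c ≤ c') :
    ∃ m : ℕ, 0 < m ∧ c ∣ 2 * m ∧
      ((List.range c).map (fun i =>
          aPwQ B N (para B N (S \ {s i, s (i + 1)})) (wl (S \ {s (i + 1)}))
            (para B N (S \ {s (i + 1), s (i + 2)})))).prod ^ (2 * m / c) =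
        aPwQ B N (para B N (S \ {s 0, s 1})) (wl S)
            (para B N (S \ {s (m : ℤ), s ((m : ℤ) + 1)})) *
          aPwQ B N (para B N (S \ {s (m : ℤ), s ((m : ℤ) + 1)})) (wl S)
            (para B N (S \ {s 0, s 1})) ∧
      (fun x => (wl S)⁻¹ * x * wl S) '' (S \ {s 0, s 1}) =
        S \ {s (m : ℤ), s ((m : ℤ) + 1)} := by
  have A : S9.BNP B N S := ⟨hSgen, hSinv, hBN1, hBN2⟩
  have C := A.cox
  have H : S9.IsLng S wl := hwl
  have U : S9.Luo S wl s := ⟨hmem, h01, hrec⟩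
  obtain ⟨m, hm, F1, F2, hsig⟩ := S9.luo_half C H U
  have hsq := S9.IsLng.sq C H (le_refl S)
  have h2m : ∀ n : ℤ, s (n + m + m) = s n := by
    intro n
    rw [hsig (n + m), hsig n, S9.IsLng.conj_conj C H le_rfl]
  have hcq : ∀ (q : ℕ) (n : ℤ), s (n + c * q) = s n := by
    intro q
    induction q with
    | zero => simp
    | succ q ih =>
      intro n
      rw [← ih n, ← hper (n + c * q)]
      congr 1
      push_cast; ring
  have hdvd : c ∣ 2 * m := by
    by_contra hn
    have hpos : 0 < (2 * m) % c := Nat.pos_of_ne_zero (fun h => hn (Nat.dvd_of_mod_eq_zero h))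
    have := hminper _ hpos (fun n => by
      rw [← hcq (2 * m / c), ← h2m n]
      congr 1
      have e : ((2 * m % c + c * (2 * m / c) : ℕ) : ℤ) = (2 * m : ℕ) := by
        rw [Nat.mod_add_div]
      push_cast at e ⊢
      linarith)
    have := Nat.mod_lt (2 * m) hc
    omega
  refine ⟨m, hm, hdvd, ?_, ?_⟩
  · have e0 : (fun i : ℤ => aPwQ B N (para B N (S \ {s i, s (i + 1)})) (wl (S \ {s (i + 1)}))
            (para B N (S \ {s (i + 1), s (i + 2)}))) = fun i : ℤ => S9.aa B N S wl s i := by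
      funext i
      unfold S9.aa S9.II S9.JJ
      rw [show i + 1 + 1 = i + 2 by ring]
    have e1 : (do let a ← List.range c; pure (a : ℤ)) = (List.range c).map (fun a : ℕ => (a : ℤ)) := by
      simp [List.map_eq_flatMap]
    have e4 : (fun i : ℤ => S9.aa B N S wl s i) ∘ (fun a : ℕ => (a : ℤ)) =
        fun i : ℕ => S9.aa B N S wl s i := rfl
    rw [e0, e1, List.map_map, e4]
    rw [S9.range_pow, Nat.mul_div_cancel' hdvd, two_mul, List.range_add, List.map_append,
      List.prod_append, S9.half_eq A H U hm F1]
    · have e2 := S9.half_eq A H (S9.luo_shift C H U m) hm F2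
      have e3 : (List.map (fun i : ℕ => S9.aa B N S wl s i) (List.map (fun x => m + x) (List.range m)))
          = (List.range m).map (fun i : ℕ => S9.aa B N S wl (fun n => s (n + m)) i) := by
        rw [List.map_map]
        congr 1
        funext i
        simp only [Function.comp, S9.aa, S9.II, S9.JJ]
        push_cast
        rw [show (m : ℤ) + i + 1 + 1 = i + 1 + 1 + m by ring, show (m : ℤ) + i + 1 = i + 1 + m by ring,
          show (m : ℤ) + i = i + m by ring]
      rw [e3, e2]
      have z0 := h2m 0
      have z1 := h2m 1
      simp only [S9.II, zero_add] at z0 z1 ⊢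
      rw [show (m : ℤ) + 1 + m = 1 + m + m by ring, z0, z1, add_comm (1 : ℤ) m]
    · intro i
      have p : ∀ n : ℤ, s ((c : ℤ) + n) = s n := fun n => by rw [add_comm]; exact hper n
      simp only [S9.aa, S9.II, S9.JJ]
      push_cast
      rw [add_assoc (c : ℤ), add_assoc (c : ℤ), p, p, p]
  · have h0 := hsig 0
    have h1 := hsig 1
    rw [zero_add] at h0
    rw [add_comm] at h1
    have hd := S9.sig_diff C H {s 0, s 1} {s (m : ℤ), s ((m : ℤ) + 1)} (fun x => by simp [h0, h1])
    rw [S9.IsLng.inv C H le_rfl]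
    ext x
    constructor
    · rintro ⟨y, hy, rfl⟩
      exact hd.1 y hy
    · intro hx
      exact ⟨_, hd.2 x hx, S9.IsLng.conj_conj C H le_rfl x⟩
end

section
/- Let I ⊆ S, let w = w_S be the longest element of W, and set J = w⁻¹ I w. Then as linear operators on the right ideal ℂG·e_{P_I} (acting by right multiplication), (a_{P_I w P_J} · a_{P_J w P_I})_r = Q(w_I)^{−2} · (a_{BwB}²)_r, where Q(w_I) = |Bw_I B|/|B|. -/
/-!
STATEMENT 10. Let G be a finite group with a BN-pair, W = N/(B ∩ N) finite with longest
element w_S, standard parabolics P_I = B W_I B with longest elements w_I, and in ℂG set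
e_P = |P|⁻¹ Σ_{x∈P} x, a_{BwB} = |B|⁻¹ Σ_{x∈BwB} x, a_{PwQ} = |Q|⁻¹ Σ_{x∈PwQ} x.
Let I ⊆ S, w = w_S, J = w⁻¹ I w. Then, as linear operators on the right ideal ℂG·e_{P_I}
(acting by right multiplication),
(a_{P_I w P_J} · a_{P_J w P_I})_r = Q(w_I)^{−2} · (a_{BwB}²)_r, Q(w_I) = |Bw_I B|/|B|.
Operator equality on the ideal is rendered as: for every v ∈ ℂG·e_{P_I}, the two right
multiplications agree on v.
-/


open scoped Pointwise

variable {G : Type*} [Group G]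

section len
variable {W : Type*} [Group W] {S : Set W}

lemma wl_le (L : List W) (h : ∀ x ∈ L, x ∈ S) : wordLen S L.prod ≤ L.length :=
  Nat.sInf_le ⟨L, rfl, h, rfl⟩

lemma clos_ind {S : Set W} (hinv : ∀ s ∈ S, s * s = 1) (p : W → Prop) (h1 : p 1)
    (hs : ∀ s ∈ S, ∀ u ∈ Subgroup.closure S, p u → p (s * u)) : ∀ u ∈ Subgroup.closure S, p u := by
  intro u hu
  induction hu using Subgroup.closure_induction_left with
  | one => exact h1
  | mul_left x hx y hy ih => exact hs x hx y hy ih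
  | inv_mul_cancel x hx y hy ih =>
    have : x⁻¹ = x := inv_eq_of_mul_eq_one_left (hinv x hx)
    rw [this]; exact hs x hx y hy ih

lemma clos_ind_r {S : Set W} (hinv : ∀ s ∈ S, s * s = 1) (p : W → Prop) (h1 : p 1)
    (hs : ∀ s ∈ S, ∀ u ∈ Subgroup.closure S, p u → p (u * s)) : ∀ u ∈ Subgroup.closure S, p u := by
  intro u hu
  have := clos_ind hinv (fun u => p u⁻¹) (by simpa using h1) (by
    intro s hs' u hu h
    have h2 : s⁻¹ = s := inv_eq_of_mul_eq_one_left (hinv s hs')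
    simp only [mul_inv_rev, h2]
    exact hs s hs' _ (inv_mem hu) h) u⁻¹ (inv_mem hu)
  simpa using this

structure GenInv (S : Set W) : Prop where
  gen : Subgroup.closure S = ⊤
  invol : ∀ s ∈ S, s * s = 1
  ne1 : ∀ s ∈ S, s ≠ 1

lemma GenInv.inv_eq (h : GenInv S) {s : W} (hs : s ∈ S) : s⁻¹ = s :=
  inv_eq_of_mul_eq_one_left (h.invol s hs)

lemma GenInv.canc (h : GenInv S) {s : W} (hs : s ∈ S) (w : W) : s * (s * w) = w := by
  rw [← mul_assoc, h.invol s hs, one_mul]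

lemma wl_word (h : GenInv S) (w : W) :
    ∃ L : List W, (∀ x ∈ L, x ∈ S) ∧ L.prod = w ∧ L.length = wordLen S w := by
  have hne : {m | ∃ L : List W, L.length = m ∧ (∀ x ∈ L, x ∈ S) ∧ L.prod = w}.Nonempty := by
    have : w ∈ Subgroup.closure S := by rw [h.gen]; trivial
    refine clos_ind h.invol (fun w => {m | ∃ L : List W, L.length = m ∧ (∀ x ∈ L, x ∈ S) ∧ L.prod = w}.Nonempty) ⟨0, [], by simp⟩ ?_ w this
    rintro s hs u - ⟨m, L, h1, h2, h3⟩
    refine ⟨_, s :: L, rfl, ?_, by simp [h3]⟩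
    intro x hx
    rcases List.mem_cons.1 hx with rfl | hx
    · exact hs
    · exact h2 x hx
  obtain ⟨L, h1, h2, h3⟩ := Nat.sInf_mem hne
  exact ⟨L, h2, h3, h1⟩

lemma wl_mul (h : GenInv S) (u v : W) : wordLen S (u * v) ≤ wordLen S u + wordLen S v := by
  obtain ⟨L, h1, h2, h3⟩ := wl_word h u
  obtain ⟨M, k1, k2, k3⟩ := wl_word h v
  rw [← h3, ← k3, ← h2, ← k2, ← List.prod_append, ← List.length_append]
  apply wl_le
  intro x hx
  rcases List.mem_append.1 hx with hx | hx
  · exact h1 x hx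
  · exact k1 x hx

lemma wl_one : wordLen S (1 : W) = 0 := by
  have := wl_le (S := S) ([] : List W) (by simp)
  simpa using this

lemma wl_zero (h : GenInv S) {w : W} (hw : wordLen S w = 0) : w = 1 := by
  obtain ⟨L, h1, h2, h3⟩ := wl_word h w
  rw [hw, List.length_eq_zero_iff] at h3
  rw [← h2, h3]; rfl

lemma wl_gen (h : GenInv S) {s : W} (hs : s ∈ S) : wordLen S s = 1 := by
  have h1 := wl_le (S := S) [s] (by simpa using hs)
  have h2 : wordLen S s ≠ 0 := fun h0 => h.ne1 s hs (wl_zero h h0)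
  simp at h1
  omega

lemma wl_inv_le (h : GenInv S) (w : W) : wordLen S w⁻¹ ≤ wordLen S w := by
  obtain ⟨L, h1, h2, h3⟩ := wl_word h w
  rw [← h3, ← h2, List.prod_inv_reverse]
  refine (wl_le _ ?_).trans (by simp)
  intro x hx
  simp only [List.mem_reverse, List.mem_map] at hx
  obtain ⟨y, hy, rfl⟩ := hx
  rw [h.inv_eq (h1 y hy)]
  exact h1 y hy

lemma wl_inv (h : GenInv S) (w : W) : wordLen S w⁻¹ = wordLen S w :=
  le_antisymm (wl_inv_le h w) (by simpa using wl_inv_le h w⁻¹)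

lemma wl_s (h : GenInv S) {s : W} (hs : s ∈ S) (w : W) : wordLen S (s * w) ≤ wordLen S w + 1 := by
  have := wl_mul h s w
  rw [wl_gen h hs] at this; omega

lemma wl_s' (h : GenInv S) {s : W} (hs : s ∈ S) (w : W) : wordLen S w ≤ wordLen S (s * w) + 1 := by
  have := wl_s h hs (s * w)
  rwa [h.canc hs] at this

lemma wl_decomp (h : GenInv S) {w : W} (hw : w ≠ 1) :
    ∃ s ∈ S, ∃ u, w = s * u ∧ wordLen S w = wordLen S u + 1 := by
  obtain ⟨L, h1, h2, h3⟩ := wl_word h w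
  cases L with
  | nil => simp at h2; exact absurd h2.symm hw
  | cons s L =>
    have hs := h1 s (by simp)
    refine ⟨s, hs, L.prod, by simp [← h2], ?_⟩
    have h4 := wl_le (S := S) L (fun x hx => h1 x (by simp [hx]))
    have h5 := wl_s h hs L.prod
    simp at h2 h3
    rw [h2] at h5
    omega

lemma wl_decomp_r (h : GenInv S) {w : W} (hw : w ≠ 1) :
    ∃ s ∈ S, ∃ u, w = u * s ∧ wordLen S w = wordLen S u + 1 := by
  obtain ⟨s, hs, u, h1, h2⟩ := wl_decomp h (w := w⁻¹) (by simpa using hw)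
  refine ⟨s, hs, u⁻¹, ?_, ?_⟩
  · rw [← inv_inj, h1]; simp [h.inv_eq hs]
  · rw [wl_inv h] at h2 ⊢; exact h2

end len

structure BNA {G W : Type*} [Group G] [Group W] (B : Subgroup G) (D : W → Set G) (S : Set W) : Prop
    extends GenInv S where
  one : D 1 = B
  inv : ∀ w g, g ∈ D w → g⁻¹ ∈ D w⁻¹
  mul : ∀ u v, D (u * v) ⊆ D u * D v
  dc : ∀ w x y, x ∈ D w → y ∈ D w → ∃ b ∈ B, ∃ c ∈ B, y = b * x * c
  left : ∀ w b x, b ∈ B → x ∈ D w → b * x ∈ D w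
  right : ∀ w b x, b ∈ B → x ∈ D w → x * b ∈ D w
  ne : ∀ w, (D w).Nonempty
  triv : ∀ w x, x ∈ D w → x ∈ B → w = 1
  bn1 : ∀ s ∈ S, ∀ w x y, x ∈ D s → y ∈ D w → x * y ∈ D (s * w) ∨ x * y ∈ D w
  bn2 : ∀ s ∈ S, ∃ x ∈ D s, ∃ y ∈ D s, x * y ∈ D s

namespace BNA
variable {W : Type*} [Group W] {B : Subgroup G} {D : W → Set G} {S : Set W}

lemma bn1r (h : BNA B D S) {s : W} (hs : s ∈ S) (w : W) {x y : G} (hx : x ∈ D w) (hy : y ∈ D s) :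
    x * y ∈ D (w * s) ∨ x * y ∈ D w := by
  have h1 := h.inv _ _ hx
  have h2 := h.inv _ _ hy
  rw [h.inv_eq hs] at h2
  rcases h.bn1 s hs _ _ _ h2 h1 with h3 | h3
  · left
    have := h.inv _ _ h3
    simpa [h.inv_eq hs] using this
  · right
    have := h.inv _ _ h3
    simpa using this

lemma uniq_aux (h : BNA B D S) : ∀ n (u v : W) (x : G), wordLen S u = n → n ≤ wordLen S v →
    x ∈ D u → x ∈ D v → u = v := by
  intro n
  induction n with
  | zero =>
    intro u v x hu hv hxu hxv
    have hu := wl_zero h.toGenInv hu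
    subst hu
    rw [h.one] at hxu
    exact (h.triv _ _ hxv hxu).symm
  | succ n ih =>
    intro u v x hu hv hxu hxv
    have hu1 : u ≠ 1 := by rintro rfl; rw [wl_one] at hu; omega
    obtain ⟨s, hs, u', rfl, hl⟩ := wl_decomp h.toGenInv hu1
    obtain ⟨a, ha, b, hb, rfl⟩ := Set.mem_mul.1 (h.mul _ _ hxu)
    have ha' := h.inv _ _ ha
    rw [h.inv_eq hs] at ha'
    have h3 := h.bn1 s hs _ _ _ ha' hxv
    rw [inv_mul_cancel_left] at h3
    rcases h3 with h3 | h3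
    · have := wl_s' h.toGenInv hs v
      have := ih u' (s * v) b (by omega) (by omega) hb h3
      rw [this, h.canc hs]
    · have := ih u' v b (by omega) (by omega) hb h3
      subst this
      omega

lemma uniq (h : BNA B D S) {u v : W} {x : G} (hu : x ∈ D u) (hv : x ∈ D v) : u = v := by
  rcases le_total (wordLen S u) (wordLen S v) with h1 | h1
  · exact h.uniq_aux _ u v x rfl h1 hu hv
  · exact (h.uniq_aux _ v u x rfl h1 hv hu).symm

lemma L1_aux (h : BNA B D S) : ∀ n (s w : W) (x y : G), s ∈ S → wordLen S w = n →
    n ≤ wordLen S (s * w) → x ∈ D s → y ∈ D w → x * y ∈ D (s * w) := by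
  intro n
  induction n with
  | zero =>
    intro s w x y hs hw _ hx hy
    have hw := wl_zero h.toGenInv hw
    subst hw
    rw [h.one] at hy
    rw [mul_one]
    exact h.right _ _ _ hy hx
  | succ n ih =>
    intro s w x y hs hw hl hx hy
    have hw1 : w ≠ 1 := by rintro rfl; rw [wl_one] at hw; omega
    obtain ⟨t, ht, w', rfl, hl'⟩ := wl_decomp_r h.toGenInv hw1
    rcases h.bn1 s hs _ _ _ hx hy with h1 | h1
    · exact h1
    exfalso
    obtain ⟨a, ha, b, hb, rfl⟩ := Set.mem_mul.1 (h.mul _ _ hy)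
    have h2 : wordLen S (s * (w' * t)) ≤ wordLen S (s * w') + 1 := by
      have := wl_mul h.toGenInv (s * w') t
      rw [wl_gen h.toGenInv ht, mul_assoc] at this
      exact this
    have h3 := ih s w' x a hs (by omega) (by omega) hx ha
    have hb' := h.inv _ _ hb
    rw [h.inv_eq ht] at hb'
    have h4 := h.bn1r ht _ h1 hb'
    rw [show x * (a * b) * b⁻¹ = x * a by group, mul_assoc w', h.invol t ht, mul_one] at h4
    rcases h4 with h4 | h4
    · have := h.uniq h3 h4
      exact h.ne1 s hs (by simpa using this)
    · have := h.uniq h3 h4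
      rw [← this, h.canc hs] at hl
      omega

lemma L1 (h : BNA B D S) {s w : W} {x y : G} (hs : s ∈ S)
    (hl : wordLen S w ≤ wordLen S (s * w)) (hx : x ∈ D s) (hy : y ∈ D w) : x * y ∈ D (s * w) :=
  h.L1_aux _ s w x y hs rfl hl hx hy

/-- If `ℓ(sw) ≤ ℓ(w)`, then `BsBwB` meets `BwB`. -/
lemma L2 (h : BNA B D S) {s w : W} (hs : s ∈ S)
    (hl : wordLen S (s * w) ≤ wordLen S w) : ∃ x ∈ D s, ∃ y ∈ D w, x * y ∈ D w := by
  obtain ⟨x, hx, y, hy, hxy⟩ := h.bn2 s hs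
  obtain ⟨z, hz⟩ := h.ne (s * w)
  have h1 : wordLen S (s * w) ≤ wordLen S (s * (s * w)) := by rwa [h.canc hs]
  have h2 := h.L1 hs h1 hy hz
  have h3 := h.L1 hs h1 hxy hz
  rw [h.canc hs] at h2 h3
  exact ⟨x, hx, y * z, h2, by rwa [← mul_assoc]⟩

lemma wl_ne (h : BNA B D S) {s : W} (hs : s ∈ S) (w : W) : wordLen S (s * w) ≠ wordLen S w := by
  intro he
  obtain ⟨x, hx, y, hy, hxy⟩ := h.L2 hs he.le
  have := h.uniq (h.L1 hs he.ge hx hy) hxy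
  exact h.ne1 s hs (by simpa using this)

lemma subw (h : BNA B D S) : ∀ (L : List W), (∀ x ∈ L, x ∈ S) → ∀ (u : W) (x y : G), x ∈ D u →
    y ∈ D L.prod → ∃ L' : List W, L'.Sublist L ∧ x * y ∈ D (u * L'.prod) := by
  intro L
  induction L with
  | nil =>
    intro _ u x y hx hy
    refine ⟨[], List.Sublist.refl _, ?_⟩
    simp [h.one] at hy ⊢
    exact h.right _ _ _ hy hx
  | cons s L ih =>
    intro hL u x y hx hy
    rw [List.prod_cons] at hy
    obtain ⟨a, ha, b, hb, rfl⟩ := Set.mem_mul.1 (h.mul _ _ hy)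
    have hL' : ∀ x ∈ L, x ∈ S := fun x hx => hL x (by simp [hx])
    rcases h.bn1r (hL s (by simp)) _ hx ha with h1 | h1
    · obtain ⟨L', h2, h3⟩ := ih hL' _ _ _ h1 hb
      refine ⟨s :: L', h2.cons_cons s, ?_⟩
      simpa [mul_assoc] using h3
    · obtain ⟨L', h2, h3⟩ := ih hL' _ _ _ h1 hb
      refine ⟨L', h2.cons s, ?_⟩
      simpa [mul_assoc] using h3

/-- exchange -/
lemma exch (h : BNA B D S) {s a : W} (hs : s ∈ S) (L : List W) (hL : ∀ x ∈ L, x ∈ S)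
    (h1 : wordLen S a ≤ wordLen S (s * a))
    (h2 : wordLen S (s * (a * L.prod)) ≤ wordLen S (a * L.prod)) :
    ∃ L' : List W, L'.Sublist L ∧ L'.length < L.length ∧ a * L.prod = s * a * L'.prod := by
  obtain ⟨x, hx, y, hy, hxy⟩ := h.L2 hs h2
  obtain ⟨p, hp, q, hq, rfl⟩ := Set.mem_mul.1 (h.mul _ _ hy)
  have h3 := h.L1 hs h1 hx hp
  obtain ⟨L', h4, h5⟩ := h.subw L hL _ _ _ h3 hq
  rw [← mul_assoc] at hxy
  have h6 := h.uniq hxy h5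
  refine ⟨L', h4, ?_, h6⟩
  refine lt_of_le_of_ne h4.length_le ?_
  intro he
  have := h4.eq_of_length he
  subst this
  exact h.ne1 s hs (by
    have := mul_right_cancel h6
    simpa using this.symm)

lemma redI (h : BNA B D S) {I : Set W} (hI : I ⊆ S) : ∀ u ∈ Subgroup.closure I,
    ∃ L : List W, (∀ x ∈ L, x ∈ I) ∧ L.prod = u ∧ L.length = wordLen S u := by
  apply clos_ind (fun s hs => h.invol s (hI hs))
  · exact ⟨[], by simp, by simp, by simp [wl_one]⟩
  · rintro s hs u - ⟨L, h1, rfl, h3⟩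
    have hs' := hI hs
    have hne := h.wl_ne hs' L.prod
    rcases lt_or_gt_of_ne hne with h4 | h4
    · have := wl_s' h.toGenInv hs' L.prod
      obtain ⟨L', k1, k2, k3⟩ := h.exch (a := 1) hs' L (fun x hx => hI (h1 x hx))
        (by rw [wl_one]; exact Nat.zero_le _) (by rw [one_mul]; exact h4.le)
      rw [one_mul, mul_one] at k3
      have k4 : ∀ x ∈ L', x ∈ I := fun x hx => h1 x (k1.subset hx)
      refine ⟨L', k4, by rw [k3, h.canc hs'], ?_⟩
      have k5 := wl_le (S := S) L' (fun x hx => hI (k4 x hx))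
      have k6 : s * L.prod = L'.prod := by rw [k3, h.canc hs']
      rw [← k6] at k5
      omega
    · have := wl_s h.toGenInv hs' L.prod
      refine ⟨s :: L, ?_, by simp, by simp; omega⟩
      intro x hx
      rcases List.mem_cons.1 hx with rfl | hx
      · exact hs
      · exact h1 x hx

lemma key (h : BNA B D S) {I : Set W} (hI : I ⊆ S) {w : W} (hw : w ∈ Subgroup.closure I)
    (hmax : ∀ u ∈ Subgroup.closure I, wordLen S u ≤ wordLen S w) {u : W}
    (hu : u ∈ Subgroup.closure I) : wordLen S w = wordLen S u + wordLen S (u⁻¹ * w) := by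
  obtain ⟨L, h1, h2, h3⟩ := h.redI hI u hu
  subst h2
  clear hu
  induction L with
  | nil => simp [wl_one]
  | cons s L ih =>
    have hs : s ∈ I := h1 s (by simp)
    have hs' := hI hs
    have h1' : ∀ x ∈ L, x ∈ I := fun x hx => h1 x (by simp [hx])
    have h4 := wl_le (S := S) L (fun x hx => hI (h1' x hx))
    simp only [List.prod_cons, List.length_cons] at h3 ⊢
    have h5 := wl_s h.toGenInv hs' L.prod
    have ih := ih h1' (by omega)
    obtain ⟨M, m1, m2, m3⟩ := wl_word h.toGenInv (L.prod⁻¹ * w)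
    have hm : L.prod * M.prod = w := by rw [m2]; simp
    obtain ⟨M', k1, k2, k3⟩ := h.exch (a := L.prod) hs' M m1 (by omega)
      (by rw [hm]; exact hmax _ (mul_mem (Subgroup.subset_closure hs) hw))
    rw [hm] at k3
    have k4 : (s * L.prod)⁻¹ * w = M'.prod := by rw [k3]; group
    have k5 := wl_le (S := S) M' (fun x hx => m1 x (k1.subset hx))
    have k6 := wl_mul h.toGenInv (s * L.prod) M'.prod
    rw [← k3] at k6
    rw [k4]
    omega

end BNA

lemma bn_count [Finite G] (B : Subgroup G) (X Y Z : Set G)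
    (hXY : ∀ x ∈ X, ∀ y ∈ Y, x * y ∈ Z) (hZ : ∀ z ∈ Z, ∃ x ∈ X, ∃ y ∈ Y, x * y = z)
    (hX : ∀ x ∈ X, ∀ b ∈ B, x * b ∈ X) (hY : ∀ b ∈ B, ∀ y ∈ Y, b * y ∈ Y)
    (hu : ∀ x ∈ X, ∀ x' ∈ X, ∀ y ∈ Y, ∀ y' ∈ Y, x * y = x' * y' → x⁻¹ * x' ∈ B) :
    X.ncard * Y.ncard = Z.ncard * (B : Set G).ncard := by
  classical
  rw [Set.ncard_eq_toFinset_card X, Set.ncard_eq_toFinset_card Y, Set.ncard_eq_toFinset_card Z,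
    Set.ncard_eq_toFinset_card (B : Set G), ← Finset.card_product]
  rw [Finset.card_eq_sum_card_fiberwise (f := fun p : G × G => p.1 * p.2)
    (t := (Set.toFinite Z).toFinset)]
  · rw [← smul_eq_mul]
    apply Finset.sum_eq_card_nsmul
    intro z hz
    rw [Set.Finite.mem_toFinset] at hz
    obtain ⟨x, hx, y, hy, rfl⟩ := hZ z hz
    symm
    apply Finset.card_bij (fun b _ => (x * b, b⁻¹ * y))
    · intro b hb
      have hb : b ∈ B := by simpa using hb
      simp [hX x hx b hb, hY _ (B.inv_mem hb) y hy]
    · intro b _ c _ hbc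
      simpa using congrArg Prod.fst hbc
    · rintro ⟨x', y'⟩ h'
      simp at h'
      obtain ⟨⟨h1, h2⟩, h3⟩ := h'
      have h4 := hu x hx x' h1 y hy y' h2 h3.symm
      refine ⟨x⁻¹ * x', by simpa using h4, ?_⟩
      ext
      · simp
      · simp [mul_assoc, ← h3]
  · rintro ⟨x, y⟩ hxy
    simp at hxy ⊢
    exact hXY x hxy.1 y hxy.2

namespace BNA
variable {W : Type*} [Group W] {B : Subgroup G} {D : W → Set G} {S : Set W}

lemma q_s [Finite G] (h : BNA B D S) {s w : W} (hs : s ∈ S)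
    (hl : wordLen S w ≤ wordLen S (s * w)) :
    (D s).ncard * (D w).ncard = (D (s * w)).ncard * (B : Set G).ncard := by
  apply bn_count
  · intro x hx y hy; exact h.L1 hs hl hx hy
  · intro z hz; exact Set.mem_mul.1 (h.mul _ _ hz)
  · intro x hx b hb; exact h.right _ _ _ hb hx
  · intro b hb x hx; exact h.left _ _ _ hb hx
  · intro x hx x' hx' y hy y' hy' he
    have h1 := h.inv _ _ hx
    rw [h.inv_eq hs] at h1
    have h2 := h.bn1 s hs _ _ _ h1 hx'
    rw [h.invol s hs, h.one] at h2
    rcases h2 with h2 | h2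
    · exact h2
    · exfalso
      have h3 := h.L1 hs hl h2 hy'
      have h4 : x⁻¹ * x' * y' = y := by rw [mul_assoc, ← he]; group
      rw [h4] at h3
      exact h.ne1 s hs (by simpa using h.uniq h3 hy)

lemma cardB [Finite G] : 0 < (B : Set G).ncard := by
  rw [Set.ncard_pos]; exact ⟨1, B.one_mem⟩

lemma add_aux [Finite G] (h : BNA B D S) : ∀ n (u v : W), wordLen S u = n →
    wordLen S (u * v) = wordLen S u + wordLen S v →
    (∀ x ∈ D u, ∀ y ∈ D v, x * y ∈ D (u * v)) ∧
      (D u).ncard * (D v).ncard = (D (u * v)).ncard * (B : Set G).ncard := by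
  intro n
  induction n with
  | zero =>
    intro u v hu _
    have hu := wl_zero h.toGenInv hu
    subst hu
    rw [h.one, one_mul, mul_comm]
    exact ⟨fun x hx y hy => h.left _ _ _ hx hy, rfl⟩
  | succ n ih =>
    intro u v hu hl
    have hu1 : u ≠ 1 := by rintro rfl; rw [wl_one] at hu; omega
    obtain ⟨s, hs, u', rfl, hl'⟩ := wl_decomp h.toGenInv hu1
    have h1 := wl_s h.toGenInv hs (u' * v)
    have h2 := wl_mul h.toGenInv u' v
    rw [mul_assoc] at hl
    obtain ⟨i1, i2⟩ := ih u' v (by omega) (by omega)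
    have h3 := h.q_s hs (w := u' * v) (by omega)
    have h4 := h.q_s hs (w := u') (by omega)
    rw [mul_assoc]
    constructor
    · intro x hx y hy
      obtain ⟨a, ha, b, hb, rfl⟩ := Set.mem_mul.1 (h.mul _ _ hx)
      rw [mul_assoc]
      exact h.L1 hs (by omega) ha (i1 b hb y hy)
    · have hB := cardB (B := B)
      apply Nat.eq_of_mul_eq_mul_right hB
      calc _ = ((D (s * u')).ncard * (B : Set G).ncard) * (D v).ncard := by ring
        _ = (D s).ncard * ((D u').ncard * (D v).ncard) := by rw [← h4]; ring
        _ = ((D s).ncard * (D (u' * v)).ncard) * (B : Set G).ncard := by rw [i2]; ring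
        _ = _ := by rw [h3]

/-- parabolic -/
lemma lmul (h : BNA B D S) {I : Set W} (hI : I ⊆ S) (v : W) : ∀ u ∈ Subgroup.closure I,
    ∀ x ∈ D u, ∀ y ∈ D v, ∃ z ∈ Subgroup.closure I, x * y ∈ D (z * v) := by
  apply clos_ind (fun s hs => h.invol s (hI hs))
  · intro x hx y hy
    rw [h.one] at hx
    exact ⟨1, one_mem _, by rw [one_mul]; exact h.left _ _ _ hx hy⟩
  · intro s hs u hu ih x hx y hy
    obtain ⟨a, ha, b, hb, rfl⟩ := Set.mem_mul.1 (h.mul _ _ hx)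
    obtain ⟨z, hz, hz'⟩ := ih b hb y hy
    rcases h.bn1 s (hI hs) _ _ _ ha hz' with h1 | h1
    · exact ⟨s * z, mul_mem (Subgroup.subset_closure hs) hz, by rwa [mul_assoc, mul_assoc]⟩
    · exact ⟨z, hz, by rwa [mul_assoc]⟩

/-- The parabolic subgroup. -/
def PS (h : BNA B D S) {I : Set W} (hI : I ⊆ S) : Subgroup G where
  carrier := {g | ∃ w ∈ Subgroup.closure I, g ∈ D w}
  one_mem' := ⟨1, one_mem _, by rw [h.one]; exact B.one_mem⟩
  inv_mem' := by
    rintro x ⟨w, hw, hx⟩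
    exact ⟨w⁻¹, inv_mem hw, h.inv _ _ hx⟩
  mul_mem' := by
    rintro x y ⟨w, hw, hx⟩ ⟨v, hv, hy⟩
    obtain ⟨z, hz, h1⟩ := h.lmul hI v w hw x hx y hy
    exact ⟨z * v, mul_mem hz hv, h1⟩

lemma B_le (h : BNA B D S) {I : Set W} (hI : I ⊆ S) {b : G} (hb : b ∈ B) : b ∈ h.PS hI :=
  ⟨1, one_mem _, by rw [h.one]; exact hb⟩

def US (D : W → Set G) (I : Set W) (w : W) : Set G := {g | ∃ x ∈ Subgroup.closure I, g ∈ D (x * w)}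

lemma US_left (h : BNA B D S) {I : Set W} (hI : I ⊆ S) (w : W) {p g : G} (hp : p ∈ h.PS hI)
    (hg : g ∈ US D I w) : p * g ∈ US D I w := by
  obtain ⟨u, hu, hp⟩ := hp
  obtain ⟨x, hx, hg⟩ := hg
  obtain ⟨z, hz, h1⟩ := h.lmul hI (x * w) u hu p hp g hg
  exact ⟨z * x, mul_mem hz hx, by rwa [mul_assoc]⟩

lemma US_right (h : BNA B D S) {I J : Set W} (hJ : J ⊆ S) (w : W)
    (hc : ∀ s ∈ J, w * s * w⁻¹ ∈ Subgroup.closure I) {p g : G}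
    (hp : p ∈ h.PS hJ) (hg : g ∈ US D I w) : g * p ∈ US D I w := by
  obtain ⟨u, hu, hp⟩ := hp
  revert p g
  refine clos_ind (fun s hs => h.invol s (hJ hs))
    (fun u => ∀ {p g : G}, g ∈ US D I w → p ∈ D u → g * p ∈ US D I w) ?_ ?_ u hu
  · rintro p g ⟨x, hx, hg⟩ hp
    rw [h.one] at hp
    exact ⟨x, hx, h.right _ _ _ hp hg⟩
  · rintro s hs u - ih p g ⟨x, hx, hg⟩ hp
    obtain ⟨a, ha, b, hb, rfl⟩ := Set.mem_mul.1 (h.mul _ _ hp)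
    rw [← mul_assoc]
    refine ih ?_ hb
    rcases h.bn1r (hJ hs) _ hg ha with h1 | h1
    · refine ⟨x * (w * s * w⁻¹), mul_mem hx (hc s hs), ?_⟩
      convert h1 using 2
      group
    · exact ⟨x, hx, h1⟩

lemma US_fac (h : BNA B D S) {I : Set W} (hI : I ⊆ S) (w : W) {g l : G} (hl : l ∈ D w)
    (hg : g ∈ US D I w) : ∃ p ∈ h.PS hI, ∃ b ∈ B, g = p * l * b := by
  obtain ⟨x, hx, hg⟩ := hg
  obtain ⟨a, ha, b, hb, rfl⟩ := Set.mem_mul.1 (h.mul _ _ hg)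
  obtain ⟨c, hc, d, hd, rfl⟩ := h.dc _ _ _ hl hb
  exact ⟨a * c, ⟨x, hx, h.right _ _ _ hc ha⟩, d, hd, by group⟩

lemma US_eq (h : BNA B D S) {I J : Set W} (hI : I ⊆ S) (hJ : J ⊆ S) (w : W)
    (hc : ∀ s ∈ J, w * s * w⁻¹ ∈ Subgroup.closure I) (L : Set G) (hL : L ⊆ D w)
    (hLn : L.Nonempty) : (h.PS hI : Set G) * L * (h.PS hJ : Set G) = US D I w := by
  ext g
  constructor
  · rintro ⟨_, ⟨p, hp, l, hl, rfl⟩, q, hq, rfl⟩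
    refine h.US_right hJ w hc hq (h.US_left hI w hp ⟨1, one_mem _, ?_⟩)
    rw [one_mul]; exact hL hl
  · intro hg
    obtain ⟨l, hl⟩ := hLn
    obtain ⟨p, hp, b, hb, rfl⟩ := h.US_fac hI w (hL hl) hg
    exact ⟨_, ⟨p, hp, l, hl, rfl⟩, b, h.B_le hJ hb, rfl⟩

lemma longest (h : BNA B D S) {w : W} (hw : ∀ u, wordLen S u ≤ wordLen S w) (u : W) :
    wordLen S w = wordLen S u + wordLen S (u⁻¹ * w) :=
  h.key (I := S) le_rfl (by rw [h.gen]; trivial) (fun u _ => hw u) (by rw [h.gen]; trivial)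

lemma longest_sq (h : BNA B D S) {w : W} (hw : ∀ u, wordLen S u ≤ wordLen S w) : w * w = 1 := by
  have h1 := h.longest hw w⁻¹
  rw [wl_inv h.toGenInv, inv_inv] at h1
  exact wl_zero h.toGenInv (by omega)

lemma longest_conj (h : BNA B D S) {w : W} (hw : ∀ u, wordLen S u ≤ wordLen S w) (u : W) :
    wordLen S (w⁻¹ * u * w) = wordLen S u := by
  have h1 := h.longest hw (u⁻¹ * w)
  have h2 := h.longest hw u
  rw [mul_inv_rev, inv_inv] at h1
  omega

lemma conj_mem (h : BNA B D S) {w : W} (hw : ∀ u, wordLen S u ≤ wordLen S w) {s : W}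
    (hs : s ∈ S) : w⁻¹ * s * w ∈ S := by
  have h1 := h.longest_conj hw s
  rw [wl_gen h.toGenInv hs] at h1
  obtain ⟨L, h2, h3, h4⟩ := wl_word h.toGenInv (w⁻¹ * s * w)
  rw [h1, List.length_eq_one_iff] at h4
  obtain ⟨t, rfl⟩ := h4
  simp at h3 h2
  rwa [← h3]

lemma ladd (h : BNA B D S) {w : W} (hw : ∀ u, wordLen S u ≤ wordLen S w) {I : Set W} (hI : I ⊆ S)
    {wI : W} (hwI : wI ∈ Subgroup.closure I)
    (hmax : ∀ u ∈ Subgroup.closure I, wordLen S u ≤ wordLen S wI) {x : W}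
    (hx : x ∈ Subgroup.closure I) :
    wordLen S (x * (wI⁻¹ * w)) = wordLen S x + wordLen S (wI⁻¹ * w) := by
  have h1 := h.longest hw wI
  have h2 := h.longest hw (wI * x⁻¹)
  have h3 := h.key hI (inv_mem hwI) (by rwa [wl_inv h.toGenInv]) (inv_mem hx)
  rw [wl_inv h.toGenInv, wl_inv h.toGenInv, inv_inv, ← wl_inv h.toGenInv (x * wI⁻¹)] at h3
  simp only [mul_inv_rev, inv_inv] at h3 h2
  rw [mul_assoc] at h2
  omega

lemma const [Finite G] (h : BNA B D S) {w : W} (hw : ∀ u, wordLen S u ≤ wordLen S w) {I : Set W}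
    (hI : I ⊆ S) {wI : W} (hwI : wI ∈ Subgroup.closure I)
    (hmax : ∀ u ∈ Subgroup.closure I, wordLen S u ≤ wordLen S wI) :
    (h.PS hI : Set G).ncard * (D w).ncard = (D wI).ncard * (US D I w).ncard := by
  have hadd := fun x hx => h.add_aux _ x _ rfl (h.ladd hw hI hwI hmax (x := x) hx)
  have h1 := (hadd wI hwI).2
  rw [mul_inv_cancel_left] at h1
  have h2 : (h.PS hI : Set G).ncard * (D (wI⁻¹ * w)).ncard =
      (US D I w).ncard * (B : Set G).ncard := by
    apply bn_count
    · rintro x ⟨u, hu, hx⟩ y hy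
      refine ⟨u * wI⁻¹, mul_mem hu (inv_mem hwI), ?_⟩
      rw [mul_assoc]
      exact (hadd u hu).1 x hx y hy
    · rintro z ⟨u, hu, hz⟩
      rw [show u * w = (u * wI) * (wI⁻¹ * w) by group] at hz
      obtain ⟨a, ha, b, hb, rfl⟩ := Set.mem_mul.1 (h.mul _ _ hz)
      exact ⟨a, ⟨_, mul_mem hu hwI, ha⟩, b, hb, rfl⟩
    · intro x hx b hb
      exact mul_mem hx (h.B_le hI hb)
    · intro b hb y hy
      exact h.left _ _ _ hb hy
    · intro x hx x' hx' y hy y' hy' he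
      obtain ⟨u, hu, hg⟩ : x⁻¹ * x' ∈ h.PS hI := mul_mem (inv_mem hx) hx'
      have h3 := (hadd u hu).1 _ hg _ hy'
      rw [show x⁻¹ * x' * y' = y by rw [mul_assoc, ← he]; group] at h3
      have h4 : u = 1 := by simpa using h.uniq h3 hy
      rw [h4, h.one] at hg
      exact hg
  apply Nat.eq_of_mul_eq_mul_right (cardB (B := B))
  calc _ = (h.PS hI : Set G).ncard * ((D w).ncard * (B : Set G).ncard) := by ring
    _ = (D wI).ncard * ((h.PS hI : Set G).ncard * (D (wI⁻¹ * w)).ncard) := by rw [← h1]; ring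
    _ = _ := by rw [h2]; ring

lemma QJ [Finite G] (h : BNA B D S) {w : W} (hw : ∀ u, wordLen S u ≤ wordLen S w) (u : W) :
    (D (w⁻¹ * u * w)).ncard = (D u).ncard := by
  have h1 := (h.add_aux _ u (u⁻¹ * w) rfl (by
    have := h.longest hw u
    rw [mul_inv_cancel_left]; exact this)).2
  have h2 := (h.add_aux _ (u⁻¹ * w) (w⁻¹ * u * w) rfl (by
    have := h.longest hw u
    rw [h.longest_conj hw, show u⁻¹ * w * (w⁻¹ * u * w) = w by group]; omega)).2
  rw [mul_inv_cancel_left] at h1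
  rw [show u⁻¹ * w * (w⁻¹ * u * w) = w by group, ← h1, mul_comm] at h2
  have h3 : 0 < (D (u⁻¹ * w)).ncard := by rw [Set.ncard_pos]; exact h.ne _
  exact Nat.eq_of_mul_eq_mul_right h3 h2

end BNA

section alg

noncomputable def sg [Fintype G] (X : Set G) : MonoidAlgebra ℂ G :=
  ∑ x ∈ (Set.toFinite X).toFinset, MonoidAlgebra.single x (1 : ℂ)

lemma sg_mul [Fintype G] (P : Set G) (X Y : Set G) (m : ℕ) [DecidableEq G]
    (hXY : ∀ x ∈ P, ∀ y ∈ X, x * y ∈ Y)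
    (hm : ∀ z ∈ Y, (((Set.toFinite P).toFinset ×ˢ (Set.toFinite X).toFinset).filter
      (fun p : G × G => p.1 * p.2 = z)).card = m) :
    sg P * sg X = (m : ℂ) • sg Y ∧ P.ncard * X.ncard = m * Y.ncard := by
  have hmap : ∀ p ∈ (Set.toFinite P).toFinset ×ˢ (Set.toFinite X).toFinset,
      p.1 * p.2 ∈ (Set.toFinite Y).toFinset := by
    rintro ⟨x, y⟩ hxy
    simp at hxy ⊢
    exact hXY x hxy.1 y hxy.2
  constructor
  · unfold sg
    rw [Finset.sum_mul_sum, ← Finset.sum_product', Finset.smul_sum,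
      ← Finset.sum_fiberwise_of_maps_to hmap]
    apply Finset.sum_congr rfl
    intro z hz
    rw [Set.Finite.mem_toFinset] at hz
    rw [← hm z hz, Nat.cast_smul_eq_nsmul]
    apply Finset.sum_eq_card_nsmul
    intro p hp
    rw [Finset.mem_filter] at hp
    rw [MonoidAlgebra.single_mul_single, hp.2, one_mul]
  · rw [Set.ncard_eq_toFinset_card P, Set.ncard_eq_toFinset_card X, Set.ncard_eq_toFinset_card Y,
      ← Finset.card_product, Finset.card_eq_sum_card_fiberwise (f := fun p : G × G => p.1 * p.2)
      (t := (Set.toFinite Y).toFinset) (fun p hp => hmap p hp), mul_comm, ← smul_eq_mul]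
    apply Finset.sum_eq_card_nsmul
    intro z hz
    rw [Set.Finite.mem_toFinset] at hz
    exact hm z hz

lemma sg_dc [Fintype G] (P B : Subgroup G) (X Y : Set G) (l : G)
    (hXY : ∀ x ∈ P, ∀ y ∈ X, x * y ∈ Y) (hX : ∀ x ∈ X, ∀ b ∈ B, x * b ∈ X)
    (hl : ∀ z ∈ Y, ∃ p ∈ P, ∃ b ∈ B, z = p * l * b) :
    ∃ m : ℕ, sg (P : Set G) * sg X = (m : ℂ) • sg Y ∧ (P : Set G).ncard * X.ncard = m * Y.ncard := by
  classical
  refine ⟨_, sg_mul (P : Set G) X Y (((Set.toFinite (P : Set G)).toFinset ×ˢ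
    (Set.toFinite X).toFinset).filter (fun p : G × G => p.1 * p.2 = l)).card hXY ?_⟩
  intro z hz
  obtain ⟨p, hp, b, hb, rfl⟩ := hl z hz
  symm
  apply Finset.card_bij (fun q _ => (p * q.1, q.2 * b))
  · rintro ⟨x, y⟩ hxy
    simp at hxy ⊢
    refine ⟨⟨mul_mem hp hxy.1.1, hX _ hxy.1.2 _ hb⟩, ?_⟩
    rw [← hxy.2]; group
  · rintro ⟨x, y⟩ _ ⟨x', y'⟩ _ he
    simpa using he
  · rintro ⟨x, y⟩ hxy
    simp at hxy
    refine ⟨(p⁻¹ * x, y * b⁻¹), ?_, by simp⟩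
    simp
    refine ⟨⟨mul_mem (inv_mem hp) hxy.1.1, hX _ hxy.1.2 _ (inv_mem hb)⟩, ?_⟩
    rw [show p⁻¹ * x * (y * b⁻¹) = p⁻¹ * (x * y) * b⁻¹ by group, hxy.2]; group

lemma sg_absorb_l [Fintype G] (P : Subgroup G) (Y : Set G) (hY : ∀ p ∈ P, ∀ y ∈ Y, p * y ∈ Y) :
    sg (P : Set G) * sg Y = ((P : Set G).ncard : ℂ) • sg Y := by
  classical
  refine (sg_mul (P : Set G) Y Y _ hY ?_).1
  intro z hz
  rw [Set.ncard_eq_toFinset_card (P : Set G)]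
  symm
  apply Finset.card_bij (fun p _ => (p, p⁻¹ * z))
  · intro p hp
    have hp : p ∈ P := by simpa using hp
    simp [hp, hY _ (inv_mem hp) z hz]
  · intro p _ q _ he
    exact congrArg Prod.fst he
  · rintro ⟨x, y⟩ hxy
    simp at hxy
    exact ⟨x, by simp [hxy.1.1], by simp [← hxy.2]⟩

lemma sg_absorb_r [Fintype G] (P : Subgroup G) (Y : Set G) (hY : ∀ y ∈ Y, ∀ p ∈ P, y * p ∈ Y) :
    sg Y * sg (P : Set G) = ((P : Set G).ncard : ℂ) • sg Y := by
  classical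
  refine (sg_mul Y (P : Set G) Y _ hY ?_).1
  intro z hz
  rw [Set.ncard_eq_toFinset_card (P : Set G)]
  symm
  apply Finset.card_bij (fun p _ => (z * p⁻¹, p))
  · intro p hp
    have hp : p ∈ P := by simpa using hp
    simp [hp, hY z hz _ (inv_mem hp)]
  · intro p _ q _ he
    exact congrArg Prod.snd he
  · rintro ⟨x, y⟩ hxy
    simp at hxy
    exact ⟨y, by simp [hxy.1.2], by simp [← hxy.2]⟩

end alg

/-- The purely algebraic end of the argument. -/
lemma bn_final {A : Type*} [Ring A] [Algebra ℂ A] (P P' T U U' : A) (p p' b t u u' q : ℂ)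
    (hp : p ≠ 0) (hp' : p' ≠ 0) (hb : b ≠ 0) (hq : q ≠ 0) (hu : u ≠ 0) (hu' : u' ≠ 0) (ht : t ≠ 0)
    (m m' : ℂ) (h1 : P * T = m • U) (h1' : P' * T = m' • U') (hm : p * t = m * u)
    (hm' : p' * t = m' * u') (hPU : P * U = p • U) (hUP' : U * P' = p' • U)
    (hc : p * t = q * u) (hc' : p' * t = q * u') :
    (p⁻¹ • P) * ((p'⁻¹ • U) * (p⁻¹ • U')) =
      ((q / b) ^ 2)⁻¹ • ((p⁻¹ • P) * ((b⁻¹ • T) * (b⁻¹ • T))) := by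
  have e : m = q := mul_right_cancel₀ hu (hm.symm.trans hc)
  have e' : m' = q := mul_right_cancel₀ hu' (hm'.symm.trans hc')
  subst e
  rw [e'] at h1'
  have h2 : P * (T * T) = (m * m * p'⁻¹) • (U * U') := by
    rw [← mul_assoc, h1, smul_mul_assoc]
    have h3 : U * T = p'⁻¹ • ((U * P') * T) := by
      rw [hUP', smul_mul_assoc, smul_smul, inv_mul_cancel₀ hp', one_smul]
    rw [h3, mul_assoc, h1', mul_smul_comm, smul_smul, smul_smul]
    congr 1; ring
  have h4 : P * (U * U') = p • (U * U') := by rw [← mul_assoc, hPU, smul_mul_assoc]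
  simp only [smul_mul_assoc, mul_smul_comm, smul_smul, h2, h4]
  congr 1
  field_simp

section conc
variable (B N : Subgroup G) [hn : ((B ⊓ N).subgroupOf N).Normal]

lemma BwB_eq (x : ↥N) (g : G) : g ∈ BwB B N (QuotientGroup.mk x) ↔
    ∃ b ∈ B, ∃ c ∈ B, g = b * x * c := by
  constructor
  · rintro ⟨_, ⟨b, hb, _, ⟨y, hy, rfl⟩, rfl⟩, c, hc, rfl⟩
    rw [eq_comm, QuotientGroup.eq] at hy
    have hy' : (x : G)⁻¹ * y ∈ B := (Subgroup.mem_subgroupOf.1 hy).1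
    refine ⟨b, hb, ((x : G)⁻¹ * y) * c, mul_mem hy' hc, by simp [mul_assoc]⟩
  · rintro ⟨b, hb, c, hc, rfl⟩
    exact ⟨_, ⟨b, hb, _, ⟨x, rfl, rfl⟩, rfl⟩, c, hc, rfl⟩

lemma conc (S : Set (↥N ⧸ (B ⊓ N).subgroupOf N))
    (hSgen : Subgroup.closure S = ⊤)
    (hSinv : ∀ s ∈ S, s * s = 1 ∧ s ≠ 1)
    (hBN1 : ∀ s ∈ S, ∀ w : ↥N ⧸ (B ⊓ N).subgroupOf N,
      lifts B N s * (B : Set G) * lifts B N w ⊆ BwB B N (s * w) ∪ BwB B N w)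
    (hBN2 : ∀ s ∈ S, ¬(lifts B N s * (B : Set G) * lifts B N s ⊆ (B : Set G))) :
    BNA B (BwB B N) S := by
  have hleft : ∀ w b x, b ∈ B → x ∈ BwB B N w → b * x ∈ BwB B N w := by
    intro w b x hb
    induction w using QuotientGroup.induction_on with | _ n =>
    simp only [BwB_eq]
    rintro ⟨c, hc, d, hd, rfl⟩
    exact ⟨b * c, mul_mem hb hc, d, hd, by group⟩
  have hright : ∀ w b x, b ∈ B → x ∈ BwB B N w → x * b ∈ BwB B N w := by
    intro w b x hb
    induction w using QuotientGroup.induction_on with | _ n =>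
    simp only [BwB_eq]
    rintro ⟨c, hc, d, hd, rfl⟩
    exact ⟨c, hc, d * b, mul_mem hd hb, by group⟩
  have hone : BwB B N 1 = B := by
    ext g
    rw [← QuotientGroup.mk_one, BwB_eq]
    constructor
    · rintro ⟨b, hb, c, hc, rfl⟩
      simpa using mul_mem hb hc
    · intro hg
      exact ⟨g, hg, 1, one_mem _, by simp⟩
  have hsub : ∀ w, lifts B N w ⊆ BwB B N w := by
    intro w g hg
    exact ⟨_, ⟨1, B.one_mem, g, hg, rfl⟩, 1, B.one_mem, by simp⟩
  refine { gen := hSgen, invol := fun s hs => (hSinv s hs).1, ne1 := fun s hs => (hSinv s hs).2,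
           one := hone, inv := ?_, mul := ?_, dc := ?_, left := hleft, right := hright, ne := ?_,
           triv := ?_, bn1 := ?_, bn2 := ?_ }
  · intro w g
    induction w using QuotientGroup.induction_on with | _ n =>
    rw [← QuotientGroup.mk_inv, BwB_eq, BwB_eq]
    rintro ⟨b, hb, c, hc, rfl⟩
    exact ⟨c⁻¹, inv_mem hc, b⁻¹, inv_mem hb, by simp [mul_assoc]⟩
  · intro u v g
    induction u using QuotientGroup.induction_on with | _ n =>
    induction v using QuotientGroup.induction_on with | _ k =>
    rw [← QuotientGroup.mk_mul, BwB_eq]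
    rintro ⟨b, hb, c, hc, rfl⟩
    refine ⟨b * n, ?_, k * c, ?_, by simp [mul_assoc]⟩
    · rw [BwB_eq]; exact ⟨b, hb, 1, one_mem _, by simp⟩
    · rw [BwB_eq]; exact ⟨1, one_mem _, c, hc, by simp⟩
  · intro w x y
    induction w using QuotientGroup.induction_on with | _ n =>
    rw [BwB_eq, BwB_eq]
    rintro ⟨b, hb, c, hc, rfl⟩ ⟨b', hb', c', hc', rfl⟩
    exact ⟨b' * b⁻¹, mul_mem hb' (inv_mem hb), c⁻¹ * c', mul_mem (inv_mem hc) hc', by group⟩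
  · intro w
    induction w using QuotientGroup.induction_on with | _ n =>
    exact ⟨n, hsub _ ⟨n, rfl, rfl⟩⟩
  · intro w x
    induction w using QuotientGroup.induction_on with | _ n =>
    rw [BwB_eq]
    rintro ⟨b, hb, c, hc, rfl⟩ hx
    rw [QuotientGroup.eq_one_iff, Subgroup.mem_subgroupOf]
    refine ⟨?_, n.2⟩
    have := mul_mem (mul_mem (inv_mem hb) hx) (inv_mem hc)
    simpa [mul_assoc] using this
  · rintro s hs w _ _ ⟨_, ⟨b, hb, l, hl, rfl⟩, c, hc, rfl⟩ ⟨_, ⟨b', hb', l', hl', rfl⟩, c', hc', rfl⟩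
    have := hBN1 s hs w ⟨_, ⟨l, hl, c * b', B.mul_mem hc hb', rfl⟩, l', hl', rfl⟩
    have e : b * l * c * (b' * l' * c') = b * (l * (c * b') * l') * c' := by group
    simp only [e]
    rcases this with h | h
    · exact Or.inl (hright _ _ _ hc' (hleft _ _ _ hb h))
    · exact Or.inr (hright _ _ _ hc' (hleft _ _ _ hb h))
  · intro s hs
    have h1 := hBN2 s hs
    rw [Set.not_subset] at h1
    obtain ⟨z, hz, hzB⟩ := h1
    have h2 := hBN1 s hs s hz
    rw [(hSinv s hs).1, hone] at h2
    obtain ⟨_, ⟨l, hl, b, hb, rfl⟩, l', hl', rfl⟩ := hz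
    rcases h2 with h2 | h2
    · exact absurd h2 hzB
    · exact ⟨l * b, hright _ _ _ hb (hsub _ hl), l', hsub _ hl', h2⟩

end conc

theorem stmt_10 [Fintype G] (B N : Subgroup G) [((B ⊓ N).subgroupOf N).Normal]
    -- BN-pair axioms
    (hGN : Subgroup.closure ((B : Set G) ∪ (N : Set G)) = ⊤)
    (S : Set (↥N ⧸ (B ⊓ N).subgroupOf N))
    (hSgen : Subgroup.closure S = ⊤)
    (hSinv : ∀ s ∈ S, s * s = 1 ∧ s ≠ 1)
    (hBN1 : ∀ s ∈ S, ∀ w : ↥N ⧸ (B ⊓ N).subgroupOf N,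
      lifts B N s * (B : Set G) * lifts B N w ⊆ BwB B N (s * w) ∪ BwB B N w)
    (hBN2 : ∀ s ∈ S, ¬(lifts B N s * (B : Set G) * lifts B N s ⊆ (B : Set G)))
    -- I ⊆ S, the longest element w = w_S of W, the longest element w_I of W_I, and J = w⁻¹Iw
    (I J : Set (↥N ⧸ (B ⊓ N).subgroupOf N)) (hIS : I ⊆ S)
    (wS : ↥N ⧸ (B ⊓ N).subgroupOf N)
    (hwS : ∀ u : ↥N ⧸ (B ⊓ N).subgroupOf N, wordLen S u ≤ wordLen S wS)
    (wI : ↥N ⧸ (B ⊓ N).subgroupOf N)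
    (hwI : wI ∈ Subgroup.closure I ∧ ∀ u ∈ Subgroup.closure I,
      wordLen S u ≤ wordLen S wI)
    (hJ : (fun x => wS⁻¹ * x * wS) '' I = J) :
    ∀ v : MonoidAlgebra ℂ G, (∃ x : MonoidAlgebra ℂ G, v = x * ePset (para B N I)) →
      v * (aPwQ B N (para B N I) wS (para B N J) * aPwQ B N (para B N J) wS (para B N I)) =
        ((((BwB B N wI).ncard : ℂ) / ((B : Set G).ncard : ℂ)) ^ 2)⁻¹ •
          (v * (aPwQ B N (B : Set G) wS (B : Set G) *
            aPwQ B N (B : Set G) wS (B : Set G))) := by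
  have h := conc B N S hSgen hSinv hBN1 hBN2
  obtain ⟨hwI1, hwI2⟩ := hwI
  have hsq := h.longest_sq hwS
  have hwinv : wS⁻¹ = wS := inv_eq_of_mul_eq_one_left hsq
  have hJS : J ⊆ S := by
    rw [← hJ]
    rintro _ ⟨s, hs, rfl⟩
    exact h.conj_mem hwS (hIS hs)
  have hcI : ∀ s ∈ J, wS * s * wS⁻¹ ∈ Subgroup.closure I := by
    rw [← hJ]
    rintro _ ⟨s, hs, rfl⟩
    apply Subgroup.subset_closure
    convert hs using 1
    group
  have hcJ : ∀ s ∈ I, wS⁻¹ * s * wS ∈ Subgroup.closure J := by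
    intro s hs
    rw [← hJ]
    exact Subgroup.subset_closure ⟨s, hs, rfl⟩
  have hcJ' : ∀ s ∈ I, wS * s * wS⁻¹ ∈ Subgroup.closure J := by
    intro s hs
    have := hcJ s hs
    rwa [hwinv] at this ⊢
  have hIJ : ∀ u ∈ Subgroup.closure I, wS⁻¹ * u * wS ∈ Subgroup.closure J := by
    apply clos_ind (fun s hs => h.invol s (hIS hs))
    · simp
    · intro s hs u _ ih
      have := mul_mem (hcJ s hs) ih
      convert this using 1
      group
  have hJI : ∀ u ∈ Subgroup.closure J, wS⁻¹ * u * wS ∈ Subgroup.closure I := by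
    apply clos_ind (fun s hs => h.invol s (hJS hs))
    · simp
    · intro s hs u _ ih
      have h1 := hcI s hs
      rw [show wS * s * wS⁻¹ = wS⁻¹ * s * wS by rw [hwinv]] at h1
      have := mul_mem h1 ih
      convert this using 1
      group
  have cI := h.const hwS hIS hwI1 hwI2
  have cJ := h.const hwS hJS (hIJ wI hwI1) (by
    intro u hu
    rw [h.longest_conj hwS, ← h.longest_conj hwS u]
    exact hwI2 _ (hJI u hu))
  rw [h.QJ hwS] at cJ
  have hlsub : lifts B N wS ⊆ BwB B N wS := by
    intro g hg
    exact ⟨_, ⟨1, B.one_mem, g, hg, rfl⟩, 1, B.one_mem, by simp⟩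
  obtain ⟨l, hl⟩ : (lifts B N wS).Nonempty := by
    induction wS using QuotientGroup.induction_on with | _ n =>
    exact ⟨n, n, rfl, rfl⟩
  have eI := h.US_eq hIS hJS wS hcI _ hlsub ⟨l, hl⟩
  have eJ := h.US_eq hJS hIS wS hcJ' _ hlsub ⟨l, hl⟩
  have hself : ∀ K : Set (↥N ⧸ (B ⊓ N).subgroupOf N), ∀ x ∈ BwB B N wS,
      x ∈ BNA.US (BwB B N) K wS := fun K x hx => ⟨1, one_mem _, by rwa [one_mul]⟩
  have hlD := hlsub hl
  obtain ⟨m, m1, m2⟩ := sg_dc (h.PS hIS) B (BwB B N wS) (BNA.US (BwB B N) I wS) l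
    (fun x hx y hy => h.US_left hIS wS hx (hself I y hy)) (fun x hx b hb => h.right _ _ _ hb hx)
    (fun z hz => h.US_fac hIS wS hlD hz)
  obtain ⟨m', m1', m2'⟩ := sg_dc (h.PS hJS) B (BwB B N wS) (BNA.US (BwB B N) J wS) l
    (fun x hx y hy => h.US_left hJS wS hx (hself J y hy)) (fun x hx b hb => h.right _ _ _ hb hx)
    (fun z hz => h.US_fac hJS wS hlD hz)
  have pos : ∀ X : Set G, X.Nonempty → (X.ncard : ℂ) ≠ 0 := by
    intro X hX
    have : 0 < X.ncard := by rw [Set.ncard_pos]; exact hX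
    exact_mod_cast this.ne'
  have key := bn_final (sg (h.PS hIS : Set G)) (sg (h.PS hJS : Set G)) (sg (BwB B N wS))
    (sg (BNA.US (BwB B N) I wS)) (sg (BNA.US (BwB B N) J wS))
    ((h.PS hIS : Set G).ncard) ((h.PS hJS : Set G).ncard) ((B : Set G).ncard)
    ((BwB B N wS).ncard) ((BNA.US (BwB B N) I wS).ncard) ((BNA.US (BwB B N) J wS).ncard)
    ((BwB B N wI).ncard) (pos _ ⟨1, one_mem _⟩) (pos _ ⟨1, one_mem _⟩) (pos _ ⟨1, one_mem _⟩)
    (pos _ (h.ne _)) (pos _ ⟨l, hself _ l hlD⟩) (pos _ ⟨l, hself _ l hlD⟩) (pos _ (h.ne _))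
    m m' m1 m1' (by exact_mod_cast m2) (by exact_mod_cast m2')
    (sg_absorb_l _ _ (fun p hp y hy => h.US_left hIS wS hp hy))
    (sg_absorb_r _ _ (fun y hy p hp => h.US_right hJS wS hcI hp hy))
    (by exact_mod_cast cI) (by exact_mod_cast cJ)
  have fI : aPwQ B N (para B N I) wS (para B N J) =
      ((h.PS hJS : Set G).ncard : ℂ)⁻¹ • sg (BNA.US (BwB B N) I wS) := by
    rw [← eI]; rfl
  have fJ : aPwQ B N (para B N J) wS (para B N I) =
      ((h.PS hIS : Set G).ncard : ℂ)⁻¹ • sg (BNA.US (BwB B N) J wS) := by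
    rw [← eJ]; rfl
  have fB : aPwQ B N (B : Set G) wS (B : Set G) =
      ((B : Set G).ncard : ℂ)⁻¹ • sg (BwB B N wS) := rfl
  have fe : ePset (para B N I) = ((h.PS hIS : Set G).ncard : ℂ)⁻¹ • sg (h.PS hIS : Set G) := rfl
  rintro v ⟨x, rfl⟩
  rw [fI, fJ, fB, fe, mul_assoc, key, mul_smul_comm, mul_assoc]
end
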